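/- arXiv:math/0511333 — 5 statements merged into one kernel-verified Lean document; each statement's English description precedes it below -/
import Mathlib

section
/- Let K be a field, let m, n be integers with 0 ≤ m ≤ n, let t ∈ K, and let x = (x_1, …, x_m) ∈ K^m have pairwise distinct entries such that t^{k}·x_i ≠ 1 for all 1 ≤ i ≤ m and 1 ≤ k ≤ n. Then F(t^{n−m+1}; x, (t^{n−1}, t^{n−2}, …, t, 1); t) = ∏_{i=1}^{m} (1 − t^{i+n−m})/(1 − t^{n}·x_i). -/
open Finset

/-- The bisymmetric function `F(u; x, y; t)` of Kirillov--Noumi. -/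
noncomputable def bisymF {K : Type*} [Field K] {m n : ℕ} (u t : K)
    (x : Fin m → K) (y : Fin n → K) : K :=
  ∑ I : Finset (Fin m),
    (-u) ^ I.card * t ^ (I.card.choose 2) *
      (∏ i ∈ I, ∏ j ∈ Iᶜ, (t * x i - x j) / (x i - x j)) *
      (∏ i ∈ I, ∏ j, (1 - x i * y j) / (1 - t * x i * y j))

lemma aux_count {m : ℕ} (I : Finset (Fin m)) :
    ∑ i : Fin m, ∑ j ∈ Ioi i, (if i ∈ I ∧ j ∈ I then 1 else 0) = I.card.choose 2 := by
  have h := Finset.sum_sum_Ioi_add_eq_sum_sum_off_diag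
    (fun i j : Fin m => if i ∈ I ∧ j ∈ I then (1 : ℕ) else 0)
  have h2 : ∀ i j : Fin m, (if j ∈ I ∧ i ∈ I then (1 : ℕ) else 0) + (if i ∈ I ∧ j ∈ I then 1 else 0)
      = 2 * (if i ∈ I ∧ j ∈ I then 1 else 0) := by
    intro i j; by_cases h1 : i ∈ I <;> by_cases h2 : j ∈ I <;> simp [h1, h2]
  simp only [h2, ← Finset.mul_sum] at h
  have h3 : ∑ i : Fin m, ∑ j ∈ ({i}ᶜ : Finset (Fin m)), (if j ∈ I ∧ i ∈ I then (1 : ℕ) else 0)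
      = I.card * (I.card - 1) := by
    have : ∀ i : Fin m, ∑ j ∈ ({i}ᶜ : Finset (Fin m)), (if j ∈ I ∧ i ∈ I then (1 : ℕ) else 0)
        = if i ∈ I then I.card - 1 else 0 := by
      intro i
      by_cases hi : i ∈ I
      · simp only [hi, and_true, if_true]
        rw [← Finset.card_filter, ← Finset.card_erase_of_mem hi]
        congr 1
        ext j; simp [Finset.mem_erase]
      · simp [hi]
    simp [this]
  rw [h3] at h
  rw [Nat.choose_two_right, ← h]
  simp

lemma aux_vand {K : Type*} [Field K] {m : ℕ} (t : K) (x : Fin m → K)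
    (hx : Function.Injective x) (I : Finset (Fin m)) :
    (Matrix.vandermonde (I.piecewise (fun i => t * x i) x)).det =
      t ^ (I.card.choose 2) * (∏ i ∈ I, ∏ j ∈ Iᶜ, (t * x i - x j) / (x i - x j)) *
        (Matrix.vandermonde x).det := by
  rw [Matrix.det_vandermonde, Matrix.det_vandermonde]
  let g : Fin m → Fin m → K := fun j i =>
    if i ∈ I ∧ j ∉ I then (t * x i - x j) / (x i - x j) else 1
  have h1 : ∏ i ∈ I, ∏ j ∈ Iᶜ, (t * x i - x j) / (x i - x j)
      = ∏ i, ∏ j ∈ Ioi i, g j i * g i j := by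
    rw [Finset.prod_prod_Ioi_mul_eq_prod_prod_off_diag, ← Finset.prod_subset (Finset.subset_univ I)]
    · refine Finset.prod_congr rfl fun i hi => ?_
      apply Finset.prod_subset_one_on_sdiff
      · intro j hj
        simp only [mem_compl, mem_singleton] at hj ⊢
        rintro rfl; exact hj hi
      · intro j hj
        simp only [mem_sdiff, mem_compl, mem_singleton, not_not] at hj
        simp [g, hj.2]
      · intro j hj
        simp only [mem_compl] at hj
        simp [g, hi, hj]
    · intro i _ hi
      simp [g, hi]
  have h2 : t ^ (I.card.choose 2) = ∏ i : Fin m, ∏ j ∈ Ioi i, (if i ∈ I ∧ j ∈ I then t else 1) := by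
    rw [← aux_count, ← Finset.prod_pow_eq_pow_sum]
    refine Finset.prod_congr rfl fun i _ => ?_
    rw [← Finset.prod_pow_eq_pow_sum]
    refine Finset.prod_congr rfl fun j _ => ?_
    split_ifs <;> simp
  rw [h1, h2]
  simp only [← Finset.prod_mul_distrib]
  refine Finset.prod_congr rfl fun i _ => Finset.prod_congr rfl fun j hj => ?_
  have hij : i ≠ j := (Finset.mem_Ioi.mp hj).ne
  have e1 : x i - x j ≠ 0 := sub_ne_zero.mpr (hx.ne hij)
  have e2 : x j - x i ≠ 0 := sub_ne_zero.mpr (hx.ne hij.symm)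
  by_cases hi : i ∈ I <;> by_cases hj : j ∈ I <;> simp [g, hi, hj, Finset.piecewise]
  · ring
  · field_simp; ring
  · field_simp

lemma aux_tri {K : Type*} [Field K] {m : ℕ} (u t : K) (x : Fin m → K) :
    (Matrix.of fun i k : Fin m => -u * (1 - x i) * (t * x i) ^ (k : ℕ)
      + (1 - u * t ^ (m - 1) * x i) * x i ^ (k : ℕ)).det
      = (Matrix.vandermonde x).det * ∏ k : Fin m, (1 - u * t ^ (k : ℕ)) := by
  let T : Matrix (Fin m) (Fin m) K := Matrix.of fun l k =>
    (if l = k then 1 - u * t ^ (k : ℕ) else 0) +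
      (if (l : ℕ) = k + 1 then - u * (t ^ (m - 1) - t ^ (k : ℕ)) else 0)
  have hT : T.det = ∏ k : Fin m, (1 - u * t ^ (k : ℕ)) := by
    rw [Matrix.det_of_isLowerTriangular]
    · simp [T]
    · intro i j hij
      have hij : i < j := by simpa using hij
      have h1 : i ≠ j := hij.ne
      have h2 : (i : ℕ) ≠ j + 1 := by have : (i : ℕ) < j := hij; omega
      simp [T, h1, h2]
  rw [← hT, ← Matrix.det_mul]
  congr 1
  ext i k
  simp only [Matrix.mul_apply, T, Matrix.of_apply, Matrix.vandermonde_apply, mul_add,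
    Finset.sum_add_distrib, mul_ite, mul_zero, Finset.sum_ite_eq', Finset.mem_univ, if_true]
  by_cases hk : (k : ℕ) + 1 < m
  · rw [Finset.sum_eq_single (⟨k + 1, hk⟩ : Fin m)]
    · simp only [if_true]; ring
    · intro b _ hb
      rw [if_neg]
      intro h; apply hb; ext; exact h
    · simp
  · have : (k : ℕ) = m - 1 := by have := k.2; omega
    rw [Finset.sum_eq_zero]
    · rw [this]; ring
    · intro b _
      rw [if_neg]
      have := b.2; omega

lemma aux_main {K : Type*} [Field K] {m : ℕ} (u t : K) (x : Fin m → K)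
    (hx : Function.Injective x) :
    ∑ I : Finset (Fin m), (-u) ^ I.card * t ^ (I.card.choose 2) *
      (∏ i ∈ I, ∏ j ∈ Iᶜ, (t * x i - x j) / (x i - x j)) *
      ((∏ i ∈ I, (1 - x i)) * ∏ i ∈ Iᶜ, (1 - u * t ^ (m - 1) * x i))
      = ∏ k : Fin m, (1 - u * t ^ (k : ℕ)) := by
  have hV : (Matrix.vandermonde x).det ≠ 0 := Matrix.det_vandermonde_ne_zero_iff.mpr hx
  apply mul_left_cancel₀ hV
  rw [← aux_tri, Finset.mul_sum]
  have h := (Matrix.detRowAlternating (n := Fin m) (R := K)).toMultilinearMap.map_add_univ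
    (fun i k => -u * (1 - x i) * (t * x i) ^ (k : ℕ))
    (fun i k => (1 - u * t ^ (m - 1) * x i) * x i ^ (k : ℕ))
  refine Eq.trans ?_ h.symm
  refine Finset.sum_congr rfl fun I _ => ?_
  have e : (I.piecewise (fun i (k : Fin m) => -u * (1 - x i) * (t * x i) ^ (k : ℕ))
      (fun i k => (1 - u * t ^ (m - 1) * x i) * x i ^ (k : ℕ)))
      = Matrix.of fun i k => (I.piecewise (fun i => -u * (1 - x i))
        (fun i => 1 - u * t ^ (m - 1) * x i)) i *
        Matrix.vandermonde (I.piecewise (fun i => t * x i) x) i k := by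
    ext i k
    by_cases hi : i ∈ I <;> simp [hi, Matrix.vandermonde_apply]
  rw [e]
  refine Eq.trans ?_ (Matrix.det_mul_column _ _).symm
  rw [aux_vand t x hx, Finset.prod_piecewise, Finset.univ_inter, ← Finset.compl_eq_univ_sdiff,
    Finset.prod_mul_distrib, Finset.prod_const]
  ring

/-- Principal specialization of `F(t^{n-m+1}; x, y; t)` at `y = (t^{n-1},…,t,1)`. -/
theorem bisymF_principal_specialization {K : Type*} [Field K] {m n : ℕ} (hmn : m ≤ n)
    (t : K) (x : Fin m → K) (hx : Function.Injective x)
    (hxt : ∀ (i : Fin m) (k : ℕ), 1 ≤ k → k ≤ n → t ^ k * x i ≠ 1) :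
    bisymF (t ^ (n - m + 1)) t x (fun j : Fin n => t ^ (n - 1 - j.val)) =
      ∏ i : Fin m, (1 - t ^ (i.val + 1 + n - m)) / (1 - t ^ n * x i) := by
  have hd : ∀ i : Fin m, 1 - t ^ n * x i ≠ 0 := by
    intro i
    have := i.2
    exact sub_ne_zero.mpr (hxt i n (by omega) le_rfl).symm
  have tel : ∀ i : Fin m, ∏ j : Fin n, (1 - x i * t ^ (n - 1 - j.val)) /
      (1 - t * x i * t ^ (n - 1 - j.val)) = (1 - x i) / (1 - t ^ n * x i) := by
    intro i
    rw [Fin.prod_univ_eq_prod_range (fun j => (1 - x i * t ^ (n - 1 - j)) /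
      (1 - t * x i * t ^ (n - 1 - j))) n,
      Finset.prod_range_reflect (fun j => (1 - x i * t ^ j) / (1 - t * x i * t ^ j)) n]
    have key : ∀ p, p ≤ n → (∏ j ∈ range p, (1 - x i * t ^ j) / (1 - t * x i * t ^ j)) *
        (1 - t ^ p * x i) = 1 - x i := by
      intro p
      induction p with
      | zero => intro _; simp
      | succ p ih =>
        intro hp
        have h0 : 1 - t * x i * t ^ p ≠ 0 := by
          have := hxt i (p + 1) (by omega) hp
          intro h
          apply this
          rw [sub_eq_zero.mp h]; ring
        have e : 1 - t ^ (p + 1) * x i = 1 - t * x i * t ^ p := by ring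
        rw [Finset.prod_range_succ, e, mul_assoc, div_mul_cancel₀ _ h0, mul_comm (x i) (t ^ p)]
        exact ih (by omega)
    exact eq_div_of_mul_eq (hd i) (key n le_rfl)
  have hD : ∏ i : Fin m, (1 - t ^ n * x i) ≠ 0 := Finset.prod_ne_zero_iff.mpr fun i _ => hd i
  rw [Finset.prod_div_distrib, eq_div_iff hD]
  unfold bisymF
  have hR : ∏ i : Fin m, (1 - t ^ (i.val + 1 + n - m))
      = ∏ k : Fin m, (1 - t ^ (n - m + 1) * t ^ (k : ℕ)) := by
    refine Finset.prod_congr rfl fun i _ => ?_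
    rw [← pow_add]; congr 2; omega
  rw [hR, ← aux_main _ t x hx, Finset.sum_mul]
  refine Finset.sum_congr rfl fun I _ => ?_
  simp only [tel]
  rw [mul_assoc]
  congr 1
  have hn : ∀ i : Fin m, 1 - t ^ (n - m + 1) * t ^ (m - 1) * x i = 1 - t ^ n * x i := by
    intro i
    have := i.2
    rw [← pow_add]; congr 3; omega
  simp only [hn]
  rw [← Finset.prod_mul_prod_compl I, ← mul_assoc, ← Finset.prod_mul_distrib]
  congr 1
  exact Finset.prod_congr rfl fun i _ => div_mul_cancel₀ _ (hd i)
end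

section
/- Let K be a field, let m, n be integers with 0 ≤ m ≤ n, let t ∈ K, and let x = (x_1, …, x_m) ∈ K^m have pairwise distinct entries such that t^{k}·x_i ≠ 1 for all 1 ≤ i ≤ m and 1 ≤ k ≤ n. Then F(1; x, (t^{n−1}, t^{n−2}, …, t, 1); t) = t^{binom(m,2)} · x_1⋯x_m · ∏_{i=1}^{m} (1 − t^{i+n−m})/(1 − t^{n}·x_i). -/
open Finset

lemma pairs_card {m : ℕ} (I : Finset (Fin m)) :
    ∑ i, ∑ j ∈ Ioi i, (if i ∈ I ∧ j ∈ I then 1 else 0 : ℕ) = I.card.choose 2 := by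
  have h := Finset.sum_sum_Ioi_add_eq_sum_sum_off_diag
    (fun i j : Fin m => (if i ∈ I ∧ j ∈ I then 1 else 0 : ℕ))
  have h1 : ∑ i : Fin m, ∑ j ∈ {i}ᶜ, (if j ∈ I ∧ i ∈ I then 1 else 0 : ℕ)
      = I.card * (I.card - 1) := by
    have : ∀ i : Fin m, ∑ j ∈ {i}ᶜ, (if j ∈ I ∧ i ∈ I then 1 else 0 : ℕ)
        = if i ∈ I then I.card - 1 else 0 := by
      intro i
      by_cases hi : i ∈ I
      · simp only [hi, and_true, if_true]
        rw [Finset.sum_boole]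
        have : ({j ∈ ({i}ᶜ : Finset (Fin m)) | j ∈ I}) = I.erase i := by
          ext j; simp
        rw [this, Finset.card_erase_of_mem hi]; simp
      · simp [hi]
    simp [this]
  rw [h1] at h
  have h2 : ∑ i : Fin m, ∑ j ∈ Ioi i, ((if j ∈ I ∧ i ∈ I then 1 else 0 : ℕ)
      + (if i ∈ I ∧ j ∈ I then 1 else 0 : ℕ))
      = 2 * ∑ i, ∑ j ∈ Ioi i, (if i ∈ I ∧ j ∈ I then 1 else 0 : ℕ) := by
    rw [Finset.mul_sum]
    refine Finset.sum_congr rfl fun i _ => ?_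
    rw [Finset.mul_sum]
    refine Finset.sum_congr rfl fun j _ => ?_
    by_cases hi : i ∈ I <;> by_cases hj : j ∈ I <;> simp [hi, hj]
  rw [h2] at h
  rw [Nat.choose_two_right]
  omega

lemma vand_ratio {K : Type*} [Field K] {m : ℕ} (t : K) (x : Fin m → K)
    (hx : Function.Injective x) (I : Finset (Fin m)) :
    (Matrix.vandermonde (fun i => if i ∈ I then t * x i else x i)).det =
      t ^ (I.card.choose 2) * (∏ i ∈ I, ∏ j ∈ Iᶜ, (t * x i - x j) / (x i - x j)) *
      (Matrix.vandermonde x).det := by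
  rw [Matrix.det_vandermonde, Matrix.det_vandermonde]
  have h1 : t ^ (I.card.choose 2) = ∏ i, ∏ j ∈ Ioi i, (if i ∈ I ∧ j ∈ I then t else 1) := by
    rw [← pairs_card, ← Finset.prod_pow_eq_pow_sum]
    refine Finset.prod_congr rfl fun i _ => ?_
    rw [← Finset.prod_pow_eq_pow_sum]
    refine Finset.prod_congr rfl fun j _ => ?_
    split_ifs <;> simp
  let P : Fin m → Fin m → K := fun i j =>
    if i ∈ I then (if j ∈ Iᶜ then (t * x i - x j) / (x i - x j) else 1) else 1
  have h2 : (∏ i ∈ I, ∏ j ∈ Iᶜ, (t * x i - x j) / (x i - x j)) =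
      ∏ i, ∏ j ∈ Ioi i, (P i j * P j i) := by
    have := Finset.prod_prod_Ioi_mul_eq_prod_prod_off_diag (fun i j => P j i)
    rw [this]
    rw [← Finset.prod_subset (Finset.subset_univ I)]
    · refine Finset.prod_congr rfl fun i hi => ?_
      rw [← Finset.prod_subset (s₁ := Iᶜ) (s₂ := {i}ᶜ)]
      · refine Finset.prod_congr rfl fun j hj => ?_
        simp only [P, if_pos hi, if_pos hj]
      · intro j hj
        simp only [Finset.mem_compl, Finset.mem_singleton] at *
        rintro rfl; exact hj hi
      · intro j _ hj
        simp only [P, if_neg hj, ite_self]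
    · intro i _ hi
      simp [P, hi]
  rw [h1, h2, ← Finset.prod_mul_distrib, ← Finset.prod_mul_distrib]
  refine Finset.prod_congr rfl fun i _ => ?_
  rw [← Finset.prod_mul_distrib, ← Finset.prod_mul_distrib]
  refine Finset.prod_congr rfl fun j hj => ?_
  have hne : i ≠ j := (Finset.mem_Ioi.1 hj).ne
  have e1 : x i - x j ≠ 0 := sub_ne_zero.2 fun h => hne (hx h)
  have e2 : x j - x i ≠ 0 := sub_ne_zero.2 fun h => hne (hx h).symm
  by_cases hi : i ∈ I <;> by_cases hj : j ∈ I <;> simp [P, hi, hj]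
  · ring
  · field_simp
    ring
  · field_simp

lemma key {K : Type*} [Field K] {m : ℕ} (q t : K) (x : Fin m → K)
    (hx : Function.Injective x) :
    ∑ I : Finset (Fin m), (-1) ^ I.card * t ^ (I.card.choose 2) *
      (∏ i ∈ I, ∏ j ∈ Iᶜ, (t * x i - x j) / (x i - x j)) *
      ((∏ i ∈ I, (1 - x i)) * ∏ i ∈ Iᶜ, (1 - q * x i))
      = (∏ i, x i) * ∏ k : Fin m, (t ^ k.val - q) := by
  have hV : (Matrix.vandermonde x).det ≠ 0 := Matrix.det_vandermonde_ne_zero_iff.2 hx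
  apply mul_right_cancel₀ hV
  let A : Matrix (Fin m) (Fin m) K := fun i j => -(1 - x i) * (t * x i) ^ j.val
  let B : Matrix (Fin m) (Fin m) K := fun i j => (1 - q * x i) * (x i) ^ j.val
  have hexp : (A + B).det = ∑ I : Finset (Fin m), (Matrix.det (I.piecewise A B : Matrix (Fin m) (Fin m) K)) :=
    (Matrix.detRowAlternating (R := K) (n := Fin m)).toMultilinearMap.map_add_univ A B
  have hterm : ∀ I : Finset (Fin m), (Matrix.det (I.piecewise A B : Matrix (Fin m) (Fin m) K)) =
      (-1) ^ I.card * t ^ (I.card.choose 2) *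
      (∏ i ∈ I, ∏ j ∈ Iᶜ, (t * x i - x j) / (x i - x j)) *
      ((∏ i ∈ I, (1 - x i)) * ∏ i ∈ Iᶜ, (1 - q * x i)) * (Matrix.vandermonde x).det := by
    intro I
    have : (I.piecewise A B : Matrix (Fin m) (Fin m) K) = Matrix.of fun i j =>
        (if i ∈ I then -(1 - x i) else (1 - q * x i)) *
        (Matrix.vandermonde (fun i => if i ∈ I then t * x i else x i)) i j := by
      ext i j
      by_cases hi : i ∈ I <;> simp [Finset.piecewise, hi, A, B, Matrix.vandermonde]
    rw [this, Matrix.det_mul_column, vand_ratio t x hx I, Finset.prod_ite, Finset.prod_neg]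
    have e1 : ({i | i ∈ I} : Finset (Fin m)) = I := by ext; simp
    have e2 : ({i | i ∉ I} : Finset (Fin m)) = Iᶜ := by ext; simp
    rw [e1, e2]
    ring
  rw [Finset.sum_mul, ← Finset.sum_congr rfl fun I _ => hterm I, ← hexp]
  let T : Matrix (Fin m) (Fin m) K := fun l j =>
    if l = j then t ^ j.val - q else if l.val + 1 = j.val then 1 - t ^ j.val else 0
  have hT : T.det = ∏ k : Fin m, (t ^ k.val - q) := by
    rw [Matrix.det_of_upperTriangular]
    · simp [T]
    · intro i j hij
      have hij' : j < i := hij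
      have h1 : i ≠ j := hij'.ne'
      have h2 : i.val + 1 ≠ j.val := by
        have : j.val < i.val := hij'
        omega
      simp [T, h1, h2]
  have hf : A + B = (Matrix.of fun i j => x i * Matrix.vandermonde x i j) * T := by
    ext i j
    rw [Matrix.mul_apply]
    have hs : ∀ l : Fin m, (Matrix.of fun i j => x i * Matrix.vandermonde x i j) i l * T l j
        = (if l = j then x i * x i ^ l.val * (t ^ j.val - q) else 0) +
          (if l.val + 1 = j.val then x i * x i ^ l.val * (1 - t ^ j.val) else 0) := by
      intro l
      by_cases h1 : l = j
      · subst h1; simp [T, Matrix.vandermonde]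
      · by_cases h2 : l.val + 1 = j.val <;> simp [T, Matrix.vandermonde, h1, h2]
    rw [Finset.sum_congr rfl fun l _ => hs l, Finset.sum_add_distrib,
      Finset.sum_ite_eq' Finset.univ j]
    simp only [Finset.mem_univ, if_true]
    have hs2 : ∑ l : Fin m, (if l.val + 1 = j.val then x i * x i ^ l.val * (1 - t ^ j.val) else 0)
        = x i ^ j.val * (1 - t ^ j.val) := by
      rcases j with ⟨j, hj⟩
      cases j with
      | zero => simp
      | succ k =>
        rw [Finset.sum_eq_single (⟨k, by omega⟩ : Fin m)]
        · rw [if_pos rfl]; ring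
        · intro b _ hb
          rw [if_neg]
          intro h
          apply hb
          ext
          simpa using h
        · simp
    rw [hs2]
    change -(1 - x i) * (t * x i) ^ j.val + (1 - q * x i) * (x i) ^ j.val = _
    ring
  rw [hf, Matrix.det_mul, Matrix.det_mul_column, hT]
  ring

lemma tele {K : Type*} [Field K] (n : ℕ) (hn : 0 < n) (t a : K)
    (h : ∀ k : ℕ, 1 ≤ k → k ≤ n → t ^ k * a ≠ 1) :
    ∏ j : Fin n, (1 - a * t ^ (n - 1 - j.val)) / (1 - t * a * t ^ (n - 1 - j.val))
      = (1 - a) / (1 - t ^ n * a) := by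
  rw [Fin.prod_univ_eq_prod_range
    (fun j => (1 - a * t ^ (n - 1 - j)) / (1 - t * a * t ^ (n - 1 - j))) n,
    Finset.prod_range_reflect (fun j => (1 - a * t ^ j) / (1 - t * a * t ^ j)) n]
  obtain ⟨k, rfl⟩ : ∃ k, n = k + 1 := ⟨n - 1, by omega⟩
  clear hn
  induction k with
  | zero => simp
  | succ k ih =>
    rw [Finset.prod_range_succ, ih fun l h1 h2 => h l h1 (by omega)]
    have e1 : 1 - t ^ (k + 1) * a ≠ 0 := sub_ne_zero.2 (h (k + 1) (by omega) (by omega)).symm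
    rw [mul_comm a (t ^ (k + 1)), show t * a * t ^ (k + 1) = t ^ (k + 1 + 1) * a by ring]
    rw [div_mul_div_comm, mul_comm (1 - a), mul_div_mul_left _ _ e1]

/-- Principal specialization of `F(1; x, y; t)` at `y = (t^{n-1},…,t,1)`. -/
theorem bisymF_one_principal_specialization {K : Type*} [Field K] {m n : ℕ} (hmn : m ≤ n)
    (t : K) (x : Fin m → K) (hx : Function.Injective x)
    (hxt : ∀ (i : Fin m) (k : ℕ), 1 ≤ k → k ≤ n → t ^ k * x i ≠ 1) :
    bisymF 1 t x (fun j : Fin n => t ^ (n - 1 - j.val)) =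
      t ^ (m.choose 2) * (∏ i, x i) *
        ∏ i : Fin m, (1 - t ^ (i.val + 1 + n - m)) / (1 - t ^ n * x i) := by
  have hd : ∀ i : Fin m, 1 - t ^ n * x i ≠ 0 := fun i =>
    sub_ne_zero.2 (hxt i n (by have := i.2; omega) le_rfl).symm
  have hD : ∏ i : Fin m, (1 - t ^ n * x i) ≠ 0 := Finset.prod_ne_zero_iff.2 fun i _ => hd i
  have hpow : t ^ (m.choose 2) = ∏ i : Fin m, t ^ (m - 1 - i.val) := by
    rw [Fin.prod_univ_eq_prod_range (fun i => t ^ (m - 1 - i)) m,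
      Finset.prod_range_reflect (fun i => t ^ i) m, Finset.prod_pow_eq_pow_sum,
      Finset.sum_range_id, Nat.choose_two_right]
  have hR : t ^ (m.choose 2) * ∏ i : Fin m, (1 - t ^ (i.val + 1 + n - m))
      = ∏ k : Fin m, (t ^ k.val - t ^ n) := by
    rw [hpow, ← Finset.prod_mul_distrib, ← Equiv.prod_comp Fin.revPerm]
    refine Finset.prod_congr rfl fun i _ => ?_
    have hi := i.2
    simp only [Fin.revPerm_apply, Fin.val_rev]
    rw [mul_sub, mul_one, ← pow_add]
    congr 2 <;> omega
  rw [Finset.prod_div_distrib, ← mul_div_assoc, eq_div_iff hD,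
    mul_right_comm, hR, mul_comm _ (∏ i, x i), ← key (t ^ n) t x hx, bisymF, Finset.sum_mul]
  refine Finset.sum_congr rfl fun I _ => ?_
  rw [Finset.prod_congr rfl fun i _ => tele n (by have := i.2; omega) t (x i) (hxt i),
    Finset.prod_div_distrib, ← Finset.prod_mul_prod_compl I (fun i => 1 - t ^ n * x i)]
  have : ∏ i ∈ I, (1 - t ^ n * x i) ≠ 0 := Finset.prod_ne_zero_iff.2 fun i _ => hd i
  field_simp
end

section
/- Let K be a field, let m, n be integers with 0 ≤ m ≤ n, let t ∈ K be nonzero, let x = (x_1, …, x_m) ∈ K^m have pairwise distinct entries, let y = (y_1, …, y_n) ∈ K^n have pairwise distinct entries, and assume x_i ≠ t·y_j for all 1 ≤ i ≤ m, 1 ≤ j ≤ n. Then ω(x, y; t) = t^{m(m−n)}·(1 − t)^m · Σ ∏_{i=1}^{m} y_{l_i}/(x_i − t·y_{l_i}) · ∏_{1 ≤ i ≤ n, i ∉ {l_1,…,l_m}} ∏_{j=1}^{m} (y_i − t·y_{l_j})/(y_i − y_{l_j}) · ∏_{1 ≤ i < j ≤ m} [(x_i − y_{l_j})/(x_i − t·y_{l_j})]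 · [(y_{l_i} − t·y_{l_j})/(y_{l_i} − y_{l_j})], where the sum is over all tuples (l_1, …, l_m) of pairwise distinct indices in {1, …, n}. -/
open Finset

/-- The bisymmetric function `ω(x, y; t)`. -/
noncomputable def bisymOmega {K : Type*} [Field K] {m n : ℕ} (t : K)
    (x : Fin m → K) (y : Fin n → K) : K :=
  ∑ I : Finset (Fin m),
    (-1 : K) ^ I.card * t ^ (I.card.choose 2) *
      (∏ i ∈ I, ∏ j ∈ Iᶜ, (x i - t * x j) / (x i - x j)) *
      (∏ i ∈ I, ∏ j, (x i - y j) / (x i - t * y j))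


theorem pf_aux {K ι : Type*} [Field K] [DecidableEq ι] (c : K) (a b : ι → K) (S : Finset ι) :
    Set.InjOn a S → ∀ z : K, (∀ s ∈ S, z ≠ a s) →
    ∏ s ∈ S, (c * z - b s) / (z - a s) = c ^ S.card +
      ∑ s ∈ S, (c * a s - b s) / (z - a s) *
        ∏ r ∈ S.erase s, (c * a s - b r) / (a s - a r) := by
  induction S using Finset.induction_on with
  | empty => intro _ z _; simp
  | insert i S hi ih =>
    intro hinj z hz
    have hinj' : Set.InjOn a S := hinj.mono (by simp)
    have hai : ∀ s ∈ S, a i ≠ a s := by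
      intro s hs h
      have := hinj (by simp) (by simp [hs]) h
      subst this; exact hi hs
    have h1 := ih hinj' z (fun s hs => hz s (by simp [hs]))
    have h2 := ih hinj' (a i) hai
    have hzi : z - a i ≠ 0 := sub_ne_zero.2 (hz i (by simp))
    rw [prod_insert hi, sum_insert hi, erase_insert hi, card_insert_of_notMem hi, h1, h2]
    have h3 : ∀ s ∈ S, (c * a s - b s) / (z - a s) *
        ∏ r ∈ (insert i S).erase s, (c * a s - b r) / (a s - a r) =
        (c * z - b i) / (z - a i) * ((c * a s - b s) / (z - a s) *
        ∏ r ∈ S.erase s, (c * a s - b r) / (a s - a r)) -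
        (c * a i - b i) / (z - a i) * ((c * a s - b s) / (a i - a s) *
        ∏ r ∈ S.erase s, (c * a s - b r) / (a s - a r)) := by
      intro s hs
      have hne : s ≠ i := fun h => hi (h ▸ hs)
      rw [erase_insert_of_ne hne.symm, prod_insert (by simp [hi])]
      have e1 : z - a s ≠ 0 := sub_ne_zero.2 (hz s (by simp [hs]))
      have e2 : a i - a s ≠ 0 := sub_ne_zero.2 (hai s hs)
      have e3 : a s - a i ≠ 0 := sub_ne_zero.2 (hai s hs).symm
      have e4 : (c * a s - b s) / (z - a s) * ((c * a s - b i) / (a s - a i)) =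
        (c * z - b i) / (z - a i) * ((c * a s - b s) / (z - a s)) -
        (c * a i - b i) / (z - a i) * ((c * a s - b s) / (a i - a s)) := by
        have : a s - a i = -(a i - a s) := by ring
        rw [this]
        field_simp
        ring
      rw [← mul_assoc, e4]; ring
    rw [sum_congr rfl h3, sum_sub_distrib, ← mul_sum, ← mul_sum]
    field_simp
    ring

noncomputable def auxA {K ι : Type*} [Field K] [DecidableEq ι] (t : K) (x h : ι → K)
    (S I : Finset ι) : K :=
  (-1 : K) ^ I.card * t ^ (I.card.choose 2) *
      (∏ i ∈ I, ∏ j ∈ S \ I, (x i - t * x j) / (x i - x j)) * (∏ i ∈ I, h i)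

theorem auxA_left {K ι : Type*} [Field K] [DecidableEq ι] (t : K) (x h : ι → K)
    (S I : Finset ι) (a : ι) (ha : a ∉ S) (hI : I ⊆ S) :
    auxA t x h (insert a S) I = auxA t x h S I * ∏ i ∈ I, (x i - t * x a) / (x i - x a) := by
  have haI : a ∉ I := fun h => ha (hI h)
  unfold auxA
  rw [insert_sdiff_of_notMem _ haI]
  simp_rw [prod_insert (show a ∉ S \ I by simp [ha])]
  rw [prod_mul_distrib]
  ring

theorem auxA_right {K ι : Type*} [Field K] [DecidableEq ι] (t : K) (x h : ι → K)
    (S I : Finset ι) (a : ι) (ha : a ∉ S) (hI : I ⊆ S) :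
    auxA t x h (insert a S) (insert a I) =
      - (auxA t x h S I * t ^ I.card * ((∏ j ∈ S \ I, (x a - t * x j) / (x a - x j)) * h a)) := by
  have haI : a ∉ I := fun h => ha (hI h)
  unfold auxA
  have : insert a S \ insert a I = S \ I := by
    ext b; simp only [mem_sdiff, mem_insert]
    by_cases hb : b = a
    · subst hb; simp [ha]
    · simp [hb]
  rw [this, prod_insert haI, prod_insert haI, card_insert_of_notMem haI, Nat.choose_succ_succ' _ 1,
    Nat.choose_one_right, pow_add, pow_succ]
  ring

theorem aux_cancel {K ι : Type*} [Field K] [DecidableEq ι] (S : Finset ι)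
    (u v : Finset ι → ι → K)
    (huv : ∀ J ⊆ S, ∀ i ∈ S, i ∉ J → u (insert i J) i = v J i) :
    ∑ I ∈ S.powerset, ∑ i ∈ I, u I i = ∑ I ∈ S.powerset, ∑ i ∈ S \ I, v I i := by
  rw [sum_sigma', sum_sigma']
  refine sum_bij' (fun p _ => ⟨p.1.erase p.2, p.2⟩) (fun p _ => ⟨insert p.2 p.1, p.2⟩) ?_ ?_ ?_ ?_ ?_
  · rintro ⟨I, i⟩ h
    simp only [mem_sigma, mem_powerset] at h
    simp only [mem_sigma, mem_powerset, mem_sdiff]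
    exact ⟨(erase_subset _ _).trans h.1, h.1 h.2, by simp⟩
  · rintro ⟨I, i⟩ h
    simp only [mem_sigma, mem_powerset, mem_sdiff] at h
    simp only [mem_sigma, mem_powerset]
    exact ⟨insert_subset h.2.1 h.1, by simp⟩
  · rintro ⟨I, i⟩ h
    simp only [mem_sigma, mem_powerset] at h
    simp [insert_erase h.2]
  · rintro ⟨I, i⟩ h
    simp only [mem_sigma, mem_powerset, mem_sdiff] at h
    simp [erase_insert h.2.2]
  · rintro ⟨I, i⟩ h
    simp only [mem_sigma, mem_powerset] at h
    simp only
    rw [← huv _ ((erase_subset _ _).trans h.1) i (h.1 h.2) (by simp), insert_erase h.2]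

theorem pf_aux2 {K ι κ : Type*} [Field K] [DecidableEq ι] [DecidableEq κ] (t : K) (ht : t ≠ 0)
    (x : ι → K) (y : κ → K) (S : Finset ι) (T : Finset κ) (z : K)
    (hx : Set.InjOn x S) (hy : Set.InjOn y T) (hxy : ∀ i ∈ S, ∀ j ∈ T, x i ≠ t * y j)
    (hzx : ∀ i ∈ S, z ≠ x i) (hzy : ∀ j ∈ T, z ≠ t * y j) :
    (∏ i ∈ S, (z - t * x i) / (z - x i)) * ∏ j ∈ T, (z - y j) / (z - t * y j) = 1 +
      ∑ i ∈ S, (x i - t * x i) / (z - x i) * ((∏ r ∈ S.erase i, (x i - t * x r) / (x i - x r)) *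
        ∏ j ∈ T, (x i - y j) / (x i - t * y j)) +
      ∑ k ∈ T, (t * y k - y k) / (z - t * y k) * ((∏ r ∈ S, (t * y k - t * x r) / (t * y k - x r)) *
        ∏ j ∈ T.erase k, (t * y k - y j) / (t * y k - t * y j)) := by
  have h := pf_aux (1 : K) (Sum.elim x (fun j => t * y j)) (Sum.elim (fun i => t * x i) y)
    (S.disjSum T) (by
      rintro (i | i) hi (j | j) hj hij
      · simp at hi hj hij; rw [hx hi hj hij]
      · simp at hi hj hij; exact absurd hij (hxy i hi j hj)
      · simp at hi hj hij; exact absurd hij.symm (hxy j hj i hi)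
      · simp [ht] at hi hj hij; rw [hy hi hj hij]) z (by
      rintro (i | i) hi
      · simp at hi; exact hzx i hi
      · simp at hi; exact hzy i hi)
  have e1 : ∀ i, (S.disjSum T).erase (Sum.inl i) = (S.erase i).disjSum T := by
    intro i; ext (j | j) <;> simp
  have e2 : ∀ i, (S.disjSum T).erase (Sum.inr i) = S.disjSum (T.erase i) := by
    intro i; ext (j | j) <;> simp
  simp only [prod_disjSum, sum_disjSum, e1, e2, Sum.elim_inl, Sum.elim_inr, one_mul, one_pow] at h
  rw [h, add_assoc]

noncomputable def auxW {K ι κ : Type*} [Field K] [DecidableEq ι] (t : K) (x : ι → K)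
    (y : κ → K) (S : Finset ι) (T : Finset κ) : K :=
  ∑ I ∈ S.powerset, auxA t x (fun i => ∏ j ∈ T, (x i - y j) / (x i - t * y j)) S I

theorem auxW_rec {K ι κ : Type*} [Field K] [DecidableEq ι] [DecidableEq κ] (t : K) (ht : t ≠ 0)
    (x : ι → K) (y : κ → K) (S : Finset ι) (T : Finset κ) (a : ι) (ha : a ∉ S)
    (hx : Function.Injective x) (hy : Function.Injective y) (hxy : ∀ i j, x i ≠ t * y j) :
    auxW t x y (insert a S) T = ∑ k ∈ T, t ^ S.card * (1 - t) * (y k / (x a - t * y k)) *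
      (∏ j ∈ T.erase k, (t * y k - y j) / (t * y k - t * y j)) *
      (∏ i ∈ S, (x i - y k) / (x i - t * y k)) * auxW t x y S (T.erase k) := by
  have hzx : ∀ i ∈ S, x a ≠ x i := fun i hi h => ha (hx h ▸ hi)
  unfold auxW
  rw [sum_powerset_insert ha]
  set h : ι → K := fun i => ∏ j ∈ T, (x i - y j) / (x i - t * y j) with hh
  have L : ∀ I ∈ S.powerset, auxA t x h (insert a S) I = auxA t x h S I * t ^ I.card +
      ∑ i ∈ I, auxA t x h S I * ((t * x i - x i) / (x a - x i) *
        ∏ r ∈ I.erase i, (t * x i - x r) / (x i - x r)) := by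
    intro I hI
    rw [mem_powerset] at hI
    rw [auxA_left t x h S I a ha hI]
    have := pf_aux t x x I hx.injOn (x a) (fun i hi => hzx i (hI hi))
    rw [← mul_sum, ← mul_add, ← this]
    congr 1
    refine prod_congr rfl fun i _ => ?_
    rw [← neg_sub, ← neg_sub (x a), neg_div_neg_eq]
  have R : ∀ I ∈ S.powerset, auxA t x h (insert a S) (insert a I) =
      - (auxA t x h S I * t ^ I.card) -
      (∑ i ∈ S \ I, auxA t x h S I * t ^ I.card * ((x i - t * x i) / (x a - x i) *
        ((∏ r ∈ (S \ I).erase i, (x i - t * x r) / (x i - x r)) * h i))) -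
      ∑ k ∈ T, auxA t x h S I * t ^ I.card * ((t * y k - y k) / (x a - t * y k) *
        ((∏ r ∈ S \ I, (t * y k - t * x r) / (t * y k - x r)) *
        ∏ j ∈ T.erase k, (t * y k - y j) / (t * y k - t * y j))) := by
    intro I hI
    rw [mem_powerset] at hI
    rw [auxA_right t x h S I a ha hI]
    have := pf_aux2 t ht x y (S \ I) T (x a) hx.injOn hy.injOn (fun i _ j _ => hxy i j)
      (fun i hi => hzx i (mem_sdiff.1 hi).1) (fun j _ => hxy a j)
    rw [← mul_sum, ← mul_sum]
    rw [this]
    ring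
  rw [sum_congr rfl L, sum_congr rfl R, sum_add_distrib, sum_sub_distrib, sum_sub_distrib,
    sum_neg_distrib]
  have C := aux_cancel S (fun I i => auxA t x h S I * ((t * x i - x i) / (x a - x i) *
        ∏ r ∈ I.erase i, (t * x i - x r) / (x i - x r)))
      (fun I i => auxA t x h S I * t ^ I.card * ((x i - t * x i) / (x a - x i) *
        ((∏ r ∈ (S \ I).erase i, (x i - t * x r) / (x i - x r)) * h i))) (by
    intro J hJ i hi hiJ

    obtain ⟨S', hS', rfl⟩ : ∃ S', i ∉ S' ∧ S = insert i S' :=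
      ⟨S.erase i, by simp, (insert_erase hi).symm⟩
    have hJ' : J ⊆ S' := (subset_insert_iff_of_notMem hiJ).1 hJ
    rw [auxA_right t x h S' J i hS' hJ', auxA_left t x h S' J i hS' hJ', erase_insert hiJ,
      insert_sdiff_of_notMem _ hiJ, erase_insert (by simp [hS'])]
    have : ∏ r ∈ J, (t * x i - x r) / (x i - x r) = ∏ r ∈ J, (x r - t * x i) / (x r - x i) := by
      refine prod_congr rfl fun r _ => ?_
      rw [← neg_sub, ← neg_sub (x r) (x i), neg_div_neg_eq]
    rw [this]
    ring)

  rw [C, sum_comm (s := S.powerset) (t := T)]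
  simp_rw [mul_sum]
  have D : ∀ k ∈ T, ∀ I ∈ S.powerset, t ^ S.card * (1 - t) * (y k / (x a - t * y k)) *
      (∏ j ∈ T.erase k, (t * y k - y j) / (t * y k - t * y j)) *
      (∏ i ∈ S, (x i - y k) / (x i - t * y k)) *
      auxA t x (fun i => ∏ j ∈ T.erase k, (x i - y j) / (x i - t * y j)) S I =
      - (auxA t x h S I * t ^ I.card * ((t * y k - y k) / (x a - t * y k) *
        ((∏ r ∈ S \ I, (t * y k - t * x r) / (t * y k - x r)) *
        ∏ j ∈ T.erase k, (t * y k - y j) / (t * y k - t * y j)))) := by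
    intro k hk I hI
    rw [mem_powerset] at hI
    have e1 : ∏ r ∈ S \ I, (t * y k - t * x r) / (t * y k - x r) =
        t ^ (S \ I).card * ∏ r ∈ S \ I, (x r - y k) / (x r - t * y k) := by
      rw [← prod_const, ← prod_mul_distrib]
      refine prod_congr rfl fun r _ => ?_
      rw [← neg_sub (x r) (t * y k), show t * y k - t * x r = -(t * (x r - y k)) by ring,
        neg_div_neg_eq, mul_div_assoc]
    have e2 : h = fun i => (x i - y k) / (x i - t * y k) *
        ∏ j ∈ T.erase k, (x i - y j) / (x i - t * y j) := by
      funext i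
      rw [hh]; exact (mul_prod_erase T (fun j => (x i - y j) / (x i - t * y j)) hk).symm
    have e3 : t ^ S.card = t ^ I.card * t ^ (S \ I).card := by
      rw [← pow_add, add_comm, card_sdiff_add_card_eq_card hI]
    rw [e1, e2, e3, ← prod_sdiff hI]
    unfold auxA
    rw [prod_mul_distrib]
    ring
  rw [sum_congr rfl fun k hk => sum_congr rfl (D k hk)]
  simp_rw [sum_neg_distrib]
  ring

theorem auxW_map {K ι κ ι' κ' : Type*} [Field K] [DecidableEq ι] [DecidableEq ι'] (t : K)
    (x : ι → K) (y : κ → K) (S : Finset ι') (T : Finset κ') (f : ι' ↪ ι) (g : κ' ↪ κ) :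
    auxW t x y (S.map f) (T.map g) = auxW t (x ∘ f) (y ∘ g) S T := by
  unfold auxW
  symm
  refine sum_bij (fun I _ => I.map f) ?_ ?_ ?_ ?_
  · intro I hI
    rw [mem_powerset] at *
    exact map_subset_map.2 hI
  · intro I _ J _ h
    exact map_injective f h
  · intro I hI
    rw [mem_powerset, subset_map_iff] at hI
    obtain ⟨J, hJ, rfl⟩ := hI
    exact ⟨J, mem_powerset.2 hJ, rfl⟩
  · intro I _
    unfold auxA
    rw [← Finset.map_sdiff]
    simp only [prod_map, card_map, Function.comp]

theorem omega_eq_auxW {K : Type*} [Field K] {m n : ℕ} (t : K)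
    (x : Fin m → K) (y : Fin n → K) : bisymOmega t x y = auxW t x y univ univ := by
  unfold bisymOmega auxW auxA
  simp only [powerset_univ, compl_eq_univ_sdiff]

theorem omega_rec {K : Type*} [Field K] {m n : ℕ} (t : K) (ht : t ≠ 0)
    (x : Fin (m + 1) → K) (y : Fin (n + 1) → K)
    (hx : Function.Injective x) (hy : Function.Injective y) (hxy : ∀ i j, x i ≠ t * y j) :
    bisymOmega t x y = ∑ k, t ^ m * (1 - t) * (y k / (x (Fin.last m) - t * y k)) *
      (∏ j, (t * y k - y (k.succAbove j)) / (t * y k - t * y (k.succAbove j))) *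
      (∏ i : Fin m, (x i.castSucc - y k) / (x i.castSucc - t * y k)) *
      bisymOmega t (x ∘ Fin.castSucc) (y ∘ k.succAbove) := by
  have e1 : (univ : Finset (Fin (m + 1))) = insert (Fin.last m) (univ.map Fin.castSuccEmb) := by
    ext i
    induction i using Fin.lastCases <;> simp
  have e2 : ∀ k : Fin (n + 1), univ.erase k = univ.map k.succAboveEmb := by
    intro k
    ext i
    simp [Fin.exists_succAbove_eq_iff]
  rw [omega_eq_auxW, e1, auxW_rec t ht x y _ univ _ (by simp [Fin.castSucc_ne_last]) hx hy hxy]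
  refine sum_congr rfl fun k _ => ?_
  rw [e2, auxW_map, omega_eq_auxW]
  simp only [prod_map, card_map, card_univ, Fintype.card_fin]
  rfl

def embSnoc {m n : ℕ} (k : Fin (n + 1)) (l : Fin m ↪ Fin n) : Fin (m + 1) ↪ Fin (n + 1) where
  toFun := Fin.snoc (α := fun _ => Fin (n + 1)) (fun i => k.succAbove (l i)) k
  inj' := by
    intro i j h
    induction i using Fin.lastCases with
    | last =>
      induction j using Fin.lastCases with
      | last => rfl
      | cast j => exact absurd (by simpa using h.symm) (Fin.succAbove_ne k (l j))
    | cast i =>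
      induction j using Fin.lastCases with
      | last => exact absurd (by simpa using h) (Fin.succAbove_ne k (l i))
      | cast j => simp at h; rw [h]

@[simp] theorem embSnoc_last {m n : ℕ} (k : Fin (n + 1)) (l : Fin m ↪ Fin n) :
    embSnoc k l (Fin.last m) = k := by
  change Fin.snoc (α := fun _ => Fin (n + 1)) (fun i => k.succAbove (l i)) k (Fin.last m) = k
  simp

@[simp] theorem embSnoc_castSucc {m n : ℕ} (k : Fin (n + 1)) (l : Fin m ↪ Fin n) (i : Fin m) :
    embSnoc k l i.castSucc = k.succAbove (l i) := by
  change Fin.snoc (α := fun _ => Fin (n + 1)) (fun i => k.succAbove (l i)) k i.castSucc = _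
  simp

theorem embSnoc_bij {m n : ℕ} : Function.Bijective
    (fun p : Fin (n + 1) × (Fin m ↪ Fin n) => embSnoc p.1 p.2) := by
  constructor
  · rintro ⟨k, l⟩ ⟨k', l'⟩ h
    simp only at h
    have h1 : k = k' := by
      rw [← embSnoc_last k l, h, embSnoc_last]
    subst h1
    congr 1
    ext i
    have := congrArg (fun e => e i.castSucc) h
    simp only [embSnoc_castSucc] at this
    rw [Fin.succAbove_right_injective this]
  · intro l
    have : ∀ i : Fin m, ∃ j, (l (Fin.last m)).succAbove j = l i.castSucc := fun i =>
      Fin.exists_succAbove_eq (fun h => (Fin.castSucc_ne_last i) (l.injective h))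
    choose f hf using this
    refine ⟨(l (Fin.last m), ⟨f, fun i j h => ?_⟩), ?_⟩
    · have : l i.castSucc = l j.castSucc := by rw [← hf, ← hf, h]
      exact Fin.castSucc_injective _ (l.injective this)
    · apply Function.Embedding.ext
      intro i
      induction i using Fin.lastCases with
      | last => simp
      | cast i => simp only [embSnoc_castSucc]; exact hf i

theorem sum_emb {K : Type*} [Field K] {m n : ℕ} (F : (Fin (m + 1) ↪ Fin (n + 1)) → K) :
    ∑ l, F l = ∑ k, ∑ l : Fin m ↪ Fin n, F (embSnoc k l) := by
  rw [← Fintype.sum_prod_type']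
  exact (Function.Bijective.sum_comp embSnoc_bij F).symm

theorem compl_map_embSnoc {m n : ℕ} (k : Fin (n + 1)) (l : Fin m ↪ Fin n) :
    (univ.map (embSnoc k l))ᶜ = ((univ.map l)ᶜ).map k.succAboveEmb := by
  ext i
  induction i using Fin.succAboveCases k with
  | x =>
    simp only [mem_compl, mem_map, mem_univ, true_and, Fin.coe_succAboveEmb]
    constructor
    · intro h; exact absurd ⟨Fin.last m, by simp⟩ h
    · rintro ⟨a, _, h⟩; exact absurd h (Fin.succAbove_ne _ _)
  | p i =>
    simp only [mem_compl, mem_map, mem_univ, true_and, Fin.coe_succAboveEmb, Fin.exists_fin_succ',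
      embSnoc_castSucc, embSnoc_last, Fin.succAbove_right_inj]
    simp [(Fin.succAbove_ne k i).symm]

theorem prod_Ioi_succ {K : Type*} [Field K] {m : ℕ} (F : Fin (m + 1) → Fin (m + 1) → K) :
    ∏ i, ∏ j ∈ Ioi i, F i j = (∏ i : Fin m, F i.castSucc (Fin.last m)) *
      ∏ i : Fin m, ∏ j ∈ Ioi i, F i.castSucc j.castSucc := by
  rw [Fin.prod_univ_castSucc, ← prod_mul_distrib]
  have : Ioi (Fin.last m) = ∅ := by ext i; simp [Fin.le_last]
  rw [this, prod_empty, mul_one]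
  refine prod_congr rfl fun i _ => ?_
  have : Ioi i.castSucc = insert (Fin.last m) ((Ioi i).map Fin.castSuccEmb) := by
    ext j
    induction j using Fin.lastCases <;> simp [Fin.castSucc_lt_last, Fin.le_last]
  rw [this, prod_insert (by simp [Fin.castSucc_ne_last]), prod_map]
  rfl

/-- The multisum expression for `ω(x,y;t)` (Corollary 3.5), where the sum ranges
over tuples `(l_1,…,l_m)` of pairwise distinct indices in `{1,…,n}`, encoded as
embeddings `Fin m ↪ Fin n`. -/
theorem bisymOmega_multisum {K : Type*} [Field K] {m n : ℕ} (hmn : m ≤ n)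
    (t : K) (ht : t ≠ 0)
    (x : Fin m → K) (y : Fin n → K)
    (hx : Function.Injective x) (hy : Function.Injective y)
    (hxy : ∀ (i : Fin m) (j : Fin n), x i ≠ t * y j) :
    bisymOmega t x y =
      t ^ ((m : ℤ) * ((m : ℤ) - (n : ℤ))) * (1 - t) ^ m *
        ∑ l : Fin m ↪ Fin n,
          (∏ i : Fin m, y (l i) / (x i - t * y (l i))) *
          (∏ i ∈ (Finset.univ.map l)ᶜ, ∏ j : Fin m,
            (y i - t * y (l j)) / (y i - y (l j))) *
          (∏ i : Fin m, ∏ j ∈ Finset.Ioi i,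
            ((x i - y (l j)) / (x i - t * y (l j))) *
            ((y (l i) - t * y (l j)) / (y (l i) - y (l j)))) := by
  induction m generalizing n with
  | zero =>
    have : bisymOmega t x y = 1 := by
      unfold bisymOmega
      rw [Fintype.sum_unique, show (default : Finset (Fin 0)) = ∅ from Subsingleton.elim _ _]
      simp
    rw [this]
    simp
  | succ m ih =>
    obtain ⟨n, rfl⟩ : ∃ n', n = n' + 1 := ⟨n - 1, by omega⟩
    rw [omega_rec t ht x y hx hy hxy, sum_emb, mul_sum]
    refine sum_congr rfl fun k _ => ?_
    rw [ih (by omega) (x ∘ Fin.castSucc) (y ∘ k.succAbove)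
      (hx.comp (Fin.castSucc_injective m)) (hy.comp Fin.succAbove_right_injective)
      (fun i j => hxy _ _), mul_sum, mul_sum, mul_sum]
    refine sum_congr rfl fun l _ => ?_
    rw [compl_map_embSnoc, prod_Ioi_succ, prod_map]
    simp only [Fin.prod_univ_castSucc (n := m), embSnoc_last, embSnoc_castSucc,
      Fin.coe_succAboveEmb, Function.comp]
    have e1 : ∏ j, (t * y k - y (k.succAbove j)) / (t * y k - t * y (k.succAbove j)) =
        t ^ (-(n : ℤ)) * ∏ j, (y (k.succAbove j) - t * y k) / (y (k.succAbove j) - y k) := by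
      rw [zpow_neg, zpow_natCast, ← inv_pow]
      have : (t⁻¹) ^ n = ∏ _j : Fin n, t⁻¹ := by simp
      rw [this, ← prod_mul_distrib]
      refine prod_congr rfl fun j _ => ?_
      rw [← mul_sub, ← neg_sub, ← neg_sub (y (k.succAbove j)), mul_neg, neg_div_neg_eq,
        div_mul_eq_div_div_swap, div_eq_mul_inv _ t, mul_comm]
    have e2 : ∏ j, (y (k.succAbove j) - t * y k) / (y (k.succAbove j) - y k) =
        (∏ i : Fin m, (y (k.succAbove (l i)) - t * y k) / (y (k.succAbove (l i)) - y k)) *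
        ∏ j ∈ (univ.map l)ᶜ, (y (k.succAbove j) - t * y k) / (y (k.succAbove j) - y k) := by
      rw [← prod_mul_prod_compl (univ.map l), prod_map]
    have e3 : t ^ (((m + 1 : ℕ) : ℤ) * (((m + 1 : ℕ) : ℤ) - ((n + 1 : ℕ) : ℤ))) =
        t ^ m * t ^ (-(n : ℤ)) * t ^ ((m : ℤ) * ((m : ℤ) - (n : ℤ))) := by
      rw [← zpow_natCast t m, ← zpow_add₀ ht, ← zpow_add₀ ht]
      congr 1
      push_cast
      ring
    rw [e1, e2, e3]
    simp only [prod_mul_distrib]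
    ring
end

section
/- Let K be a field, let m, n be integers with 0 ≤ m ≤ n, let t ∈ K be nonzero with t^i ≠ 1 for all 1 ≤ i ≤ max(m, n−m), let x = (x_1, …, x_m) ∈ K^m have pairwise distinct entries, let y = (y_1, …, y_n) ∈ K^n have pairwise distinct entries, and assume x_i ≠ t·y_j for all 1 ≤ i ≤ m, 1 ≤ j ≤ n. Then ω(x, y; t) = [t^{m(m−n)}·(1 − t)^{n+m} / ((t;t)_{n−m}·(t;t)_m)] · Σ_{(σ,τ) ∈ S_m × S_n} ∏_{i=1}^{m} y_{τ(i+n−m)}/(x_{σ(i)} − t·y_{τ(i+n−m)}) · ∏_{1 ≤ i < j ≤ n} (y_{τ(i)} − t·y_{τ(j)})/(y_{τ(i)} − y_{τ(j)}) · ∏_{1 ≤ i < j ≤ m} [(x_{σ(i)} − y_{τ(j+n−m)})/(x_{σ(i)} − t·y_{τ(j+n−m)})] · [(x_{σ(i)} − t·x_{σ(j)})/(x_{σ(i)} − x_{σ(j)})], where S_m and S_n are the symmetric groups on {1,…,m} and {1,…,n}. -/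
open Finset

/-- The shift `i ↦ i + (n - m)` mapping `{1,…,m}` into `{1,…,n}`. -/
def iotaMap (m n : ℕ) (h : m ≤ n) (i : Fin m) : Fin n :=
  Fin.cast (by omega) (i.addNat (n - m))


namespace BisymAux

set_option linter.unusedSectionVars false

section
variable {K : Type*} [Field K] [DecidableEq K]

/-- A -/
noncomputable def fA (t k : K) (S : Finset K) : K := ∏ i ∈ S, (k - t * i) / (k - i)
/-- B -/
noncomputable def fB (t k : K) (S : Finset K) : K := ∏ i ∈ S, (i - t * k) / (i - k)
/-- P -/
noncomputable def fP (t : K) (Y : Finset K) (z : K) : K := ∏ y ∈ Y, (z - y) / (z - t * y)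
/-- Q -/
noncomputable def fQ (t b : K) (J : Finset K) : K := ∏ i ∈ J, (i - b) / (i - t * b)

/-- summand -/
noncomputable def fW (t : K) (P : K → K) (T U : Finset K) : K :=
  (-1 : K) ^ T.card * t ^ (T.card.choose 2) * (∏ i ∈ T, fA t i U) * (∏ i ∈ T, P i)

/-- omega on finsets -/
noncomputable def om (t : K) (s Y : Finset K) : K :=
  ∑ T ∈ s.powerset, fW t (fP t Y) T (s \ T)


theorem partial_frac {ι : Type*} [DecidableEq ι] (v c : ι → K) (s : Finset ι) :
    ∀ z : K, (∀ i ∈ s, z ≠ v i) → (∀ i ∈ s, ∀ j ∈ s, i ≠ j → v i ≠ v j) →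
    ∏ i ∈ s, (z - c i) / (z - v i) =
      1 + ∑ i ∈ s, (v i - c i) / (z - v i) * ∏ w ∈ s.erase i, (v i - c w) / (v i - v w) := by
  induction s using Finset.induction_on with
  | empty => intro z _ _; simp
  | insert w s hw ih =>
    intro z hz hv
    have hzw : z - v w ≠ 0 := sub_ne_zero.2 (hz w (mem_insert_self _ _))
    have hv' : ∀ i ∈ s, ∀ j ∈ s, i ≠ j → v i ≠ v j := fun i hi j hj =>
      hv i (mem_insert_of_mem hi) j (mem_insert_of_mem hj)
    have hwv : ∀ i ∈ s, v w ≠ v i := fun i hi =>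
      hv w (mem_insert_self _ _) i (mem_insert_of_mem hi) (by rintro rfl; exact hw hi)
    have h1 := ih z (fun i hi => hz i (mem_insert_of_mem hi)) hv'
    have h2 := ih (v w) hwv hv'
    rw [prod_insert hw, sum_insert hw, erase_insert hw, h1, h2]
    have h3 : ∀ i ∈ s, (v i - c i) / (z - v i) *
        ∏ w' ∈ (insert w s).erase i, (v i - c w') / (v i - v w') =
        (z - c w) / (z - v w) * ((v i - c i) / (z - v i) *
          ∏ w' ∈ s.erase i, (v i - c w') / (v i - v w'))
        - (v w - c w) / (z - v w) * ((v i - c i) / (v w - v i) *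
          ∏ w' ∈ s.erase i, (v i - c w') / (v i - v w')) := by
      intro i hi
      have hiw : w ≠ i := by rintro rfl; exact hw hi
      rw [erase_insert_of_ne hiw, prod_insert (by simp [hw])]
      have a1 : z - v i ≠ 0 := sub_ne_zero.2 (hz i (mem_insert_of_mem hi))
      have a2 : v w - v i ≠ 0 := sub_ne_zero.2 (hwv i hi)
      have a3 : v i - v w ≠ 0 := sub_ne_zero.2 (hwv i hi).symm
      have a4 : (v i - c w) / (v i - v w) = - ((v i - c w) / (v w - v i)) := by
        rw [← neg_sub (v w) (v i), div_neg]
      rw [a4]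
      generalize ∏ w' ∈ s.erase i, (v i - c w') / (v i - v w') = p
      field_simp
      ring
    rw [sum_congr rfl h3, sum_sub_distrib, ← mul_sum, ← mul_sum]
    generalize ∑ i ∈ s, (v i - c i) / (z - v i) *
          ∏ w' ∈ s.erase i, (v i - c w') / (v i - v w') = p
    generalize ∑ i ∈ s, (v i - c i) / (v w - v i) *
          ∏ w' ∈ s.erase i, (v i - c w') / (v i - v w') = q
    field_simp
    ring

theorem L1 (t : K) (S : Finset K) :
    ∀ z : K, z ∉ S → fB t z S = 1 + (1 - t) * ∑ a ∈ S, z / (a - z) * fB t a (S.erase a) := by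
  induction S using Finset.induction_on with
  | empty => intro z _; simp [fB]
  | insert w s hw ih =>
    intro z hz
    rw [mem_insert, not_or] at hz
    have hzw : w - z ≠ 0 := sub_ne_zero.2 (Ne.symm hz.1)
    have h1 := ih z hz.2
    have h2 := ih w hw
    have h0 : fB t z (insert w s) = (w - t * z) / (w - z) * fB t z s := by
      rw [fB, prod_insert hw, fB]
    rw [h0, sum_insert hw, erase_insert hw, h1, h2]
    have h3 : ∀ a ∈ s, z / (a - z) * fB t a ((insert w s).erase a) =
        (w - t * z) / (w - z) * (z / (a - z) * fB t a (s.erase a))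
        - (1 - t) * (z / (w - z)) * (w / (a - w) * fB t a (s.erase a)) := by
      intro i hi
      have hiw : w ≠ i := by rintro rfl; exact hw hi
      rw [erase_insert_of_ne hiw, fB, prod_insert (by simp [hw]), ← fB]
      have a1 : i - z ≠ 0 := sub_ne_zero.2 (by rintro rfl; exact hz.2 hi)
      have a2 : i - w ≠ 0 := sub_ne_zero.2 hiw.symm
      have a4 : (w - t * i) / (w - i) = - ((w - t * i) / (i - w)) := by
        rw [← neg_sub i w, div_neg]
      rw [a4]
      generalize fB t i (s.erase i) = p
      field_simp
      ring
    rw [sum_congr rfl h3, sum_sub_distrib, ← mul_sum, ← mul_sum]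
    generalize ∑ a ∈ s, z / (a - z) * fB t a (s.erase a) = p
    generalize ∑ a ∈ s, w / (a - w) * fB t a (s.erase a) = q
    field_simp
    ring

theorem L2 (t : K) (S : Finset K) :
    (1 - t) * ∑ a ∈ S, fB t a (S.erase a) = 1 - t ^ S.card := by
  induction S using Finset.induction_on with
  | empty => simp
  | insert w s hw ih =>
    rw [sum_insert hw, erase_insert hw, L1 t s w hw, card_insert_of_notMem hw]
    have h3 : ∀ a ∈ s, fB t a ((insert w s).erase a) =
        t * fB t a (s.erase a) - (1 - t) * (w / (a - w) * fB t a (s.erase a)) := by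
      intro i hi
      have hiw : w ≠ i := by rintro rfl; exact hw hi
      rw [erase_insert_of_ne hiw, fB, prod_insert (by simp [hw]), ← fB]
      have a2 : i - w ≠ 0 := sub_ne_zero.2 hiw.symm
      have a4 : (w - t * i) / (w - i) = - ((w - t * i) / (i - w)) := by
        rw [← neg_sub i w, div_neg]
      rw [a4]
      generalize fB t i (s.erase i) = p
      field_simp
      ring
    rw [sum_congr rfl h3, sum_sub_distrib, ← mul_sum, ← mul_sum]
    linear_combination t * ih

theorem L3 (t : K) (ht : t ≠ 0) (Y J : Finset K) (a : K) (ha : a ∉ J)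
    (haY : ∀ y ∈ Y, a ≠ t * y) (hJY : ∀ i ∈ J, ∀ y ∈ Y, i ≠ t * y) :
    (1 - t) * t ^ (J.card + 1) * ∑ b ∈ Y, b / (a - t * b) * fB t b (Y.erase b) * fQ t b J =
    t ^ Y.card * (1 - fP t Y a * fA t a J +
      (1 - t) * ∑ k ∈ J, fP t Y k * (k / (a - k)) * fA t k (J.erase k)) := by
  have key := partial_frac (Sum.elim (fun y : K => t * y) (fun i => i))
    (Sum.elim (fun y : K => y) (fun i => t * i)) (Y.disjSum J) a ?_ ?_
  · rw [prod_disjSum, sum_disjSum] at key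
    have e1 : ∀ b, (Y.disjSum J).erase (Sum.inl b) = (Y.erase b).disjSum J := by
      intro b; ext x; cases x <;> simp
    have e2 : ∀ b, (Y.disjSum J).erase (Sum.inr b) = Y.disjSum (J.erase b) := by
      intro b; ext x; cases x <;> simp
    simp only [e1, e2, prod_disjSum, Sum.elim_inl, Sum.elim_inr] at key
    have f1 : ∀ b ∈ Y, t ^ Y.card * ((t * b - b) / (a - t * b) * ((∏ x ∈ Y.erase b, (t * b - x) / (t * b - t * x)) *
        ∏ x ∈ J, (t * b - t * x) / (t * b - x))) =
        - ((1 - t) * t ^ (J.card + 1)) * (b / (a - t * b) * fB t b (Y.erase b) * fQ t b J) := by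
      intro b hb
      have g1 : t ^ (Y.card - 1) * ∏ x ∈ Y.erase b, (t * b - x) / (t * b - t * x) = fB t b (Y.erase b) := by
        rw [← card_erase_of_mem hb, ← prod_const, ← prod_mul_distrib, fB]
        refine prod_congr rfl fun x hx => ?_
        have : x - b ≠ 0 := sub_ne_zero.2 (ne_of_mem_erase hx)
        have : b - x ≠ 0 := sub_ne_zero.2 (ne_of_mem_erase hx).symm
        rw [← mul_sub]
        field_simp
        ring
      have g2 : ∏ x ∈ J, (t * b - t * x) / (t * b - x) = t ^ J.card * fQ t b J := by
        rw [← prod_const, fQ, ← prod_mul_distrib]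
        refine prod_congr rfl fun x hx => ?_
        have h : x - t * b ≠ 0 := sub_ne_zero.2 (hJY x hx b hb)
        rw [← neg_sub x (t * b), div_neg]
        field_simp
        ring
      have g3 : t ^ Y.card = t * t ^ (Y.card - 1) := by
        rw [← pow_succ', Nat.sub_add_cancel (card_pos.2 ⟨b, hb⟩)]
      rw [g2, ← g1, g3]
      ring
    have f2 : ∀ k ∈ J, (k - t * k) / (a - k) * ((∏ x ∈ Y, (k - x) / (k - t * x)) *
        ∏ x ∈ J.erase k, (k - t * x) / (k - x)) =
        (1 - t) * (fP t Y k * (k / (a - k)) * fA t k (J.erase k)) := by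
      intro k _
      rw [fP, fA]; ring
    rw [sum_congr rfl f2, ← mul_sum] at key
    have f3 := sum_congr rfl f1
    rw [← mul_sum, ← mul_sum] at f3
    rw [← fP, ← fA] at key
    linear_combination f3 + t ^ Y.card * key
  · rintro (y | i) h
    · simpa using haY y (by simpa using h)
    · rintro rfl; exact ha (by simpa using h)
  · rintro (y | i) h (y' | i') h' hne
    · simpa [ht] using hne
    · simpa using (hJY i' (by simpa using h') y (by simpa using h)).symm
    · simpa using (hJY i (by simpa using h) y' (by simpa using h'))
    · simpa using hne

theorem E2 (s : Finset K) (g : K → Finset K → K) :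
    ∑ a ∈ s, ∑ I ∈ (s.erase a).powerset, g a I = ∑ T ∈ s.powerset, ∑ a ∈ s \ T, g a T := by
  apply sum_comm'
  intro a I
  simp only [mem_powerset, mem_sdiff, subset_erase]
  tauto

theorem E1 (s : Finset K) (g : K → Finset K → K) :
    ∑ a ∈ s, ∑ I ∈ (s.erase a).powerset, g a I =
      ∑ T ∈ s.powerset, ∑ a ∈ T, g a (T.erase a) := by
  rw [sum_sigma', sum_sigma']
  refine sum_bij' (fun p _ => ⟨insert p.1 p.2, p.1⟩) (fun p _ => ⟨p.2, p.1.erase p.2⟩) ?_ ?_ ?_ ?_ ?_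
  · rintro ⟨a, I⟩ h
    simp only [mem_sigma, mem_powerset, subset_erase] at h ⊢
    exact ⟨insert_subset h.1 h.2.1, mem_insert_self _ _⟩
  · rintro ⟨T, a⟩ h
    simp only [mem_sigma, mem_powerset] at h ⊢
    exact ⟨h.1 h.2, erase_subset_erase _ h.1⟩
  · rintro ⟨a, I⟩ h
    simp only [mem_sigma, mem_powerset, subset_erase] at h
    simp [erase_insert h.2.2]
  · rintro ⟨T, a⟩ h
    simp only [mem_sigma, mem_powerset] at h
    simp [insert_erase h.2]
  · rintro ⟨a, I⟩ h
    simp only [mem_sigma, mem_powerset, subset_erase] at h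
    simp [erase_insert h.2.2]

theorem E3 (s : Finset K) (g : K → Finset K → K → K) :
    ∑ a ∈ s, ∑ I ∈ (s.erase a).powerset, ∑ k ∈ (s.erase a) \ I, g a I k =
      ∑ T ∈ s.powerset, ∑ k ∈ T, ∑ a ∈ s \ T, g a (T.erase k) k := by
  have h := E1 s (fun k I => ∑ a ∈ (s.erase k) \ I, g a I k)
  rw [E2] at h ⊢
  trans ∑ T ∈ s.powerset, ∑ k ∈ s \ T, ∑ a ∈ s.erase k \ T, g a T k
  · refine sum_congr rfl fun T _ => ?_
    apply sum_comm'
    intro a k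
    simp only [mem_sdiff, mem_erase]
    tauto
  · rw [h]
    refine sum_congr rfl fun T _ => sum_congr rfl fun k hk => ?_
    refine sum_congr ?_ fun _ _ => rfl
    ext a
    simp only [mem_sdiff, mem_erase]
    by_cases h : a = k
    · subst h; simp [hk]
    · simp [h]

theorem fA_union (t k : K) (S U : Finset K) (h : Disjoint S U) :
    fA t k (S ∪ U) = fA t k S * fA t k U := prod_union h
theorem fB_union (t k : K) (S U : Finset K) (h : Disjoint S U) :
    fB t k (S ∪ U) = fB t k S * fB t k U := prod_union h

theorem fW_insert_right (t : K) (P : K → K) (T U : Finset K) (a : K) (ha : a ∉ U) :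
    fW t P T (insert a U) = fW t P T U * fB t a T := by
  have : ∏ i ∈ T, fA t i (insert a U) = (∏ i ∈ T, fA t i U) * fB t a T := by
    rw [fB, ← prod_mul_distrib]
    refine prod_congr rfl fun i _ => ?_
    rw [fA, prod_insert ha, fA, mul_comm]
  rw [fW, fW, this]; ring

theorem fW_insert_left (t : K) (P : K → K) (T U : Finset K) (a : K) (ha : a ∉ T) :
    fW t P (insert a T) U = - (t ^ T.card * fW t P T U * fA t a U * P a) := by
  rw [fW, fW, prod_insert ha, prod_insert ha, card_insert_of_notMem ha, Nat.choose_succ_succ' _ 1,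
    Nat.choose_one_right, pow_add, pow_succ]
  ring

theorem step3 (t : K) (P : K → K) (s : Finset K) :
    (1 - t ^ s.card) * ∑ T ∈ s.powerset, fW t P T (s \ T) =
    (1 - t) * ∑ a ∈ s, ∑ I ∈ (s.erase a).powerset,
      t ^ I.card * fW t P I (s.erase a \ I) * fB t a (s.erase a) *
        (1 - P a * fA t a (s.erase a \ I) + (1 - t) * ∑ k ∈ s.erase a \ I,
          P k * (k / (a - k)) * fA t k ((s.erase a \ I).erase k)) := by
  have hsplit : ∑ a ∈ s, ∑ I ∈ (s.erase a).powerset,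
      t ^ I.card * fW t P I (s.erase a \ I) * fB t a (s.erase a) *
        (1 - P a * fA t a (s.erase a \ I) + (1 - t) * ∑ k ∈ s.erase a \ I,
          P k * (k / (a - k)) * fA t k ((s.erase a \ I).erase k)) =
      ∑ a ∈ s, ∑ I ∈ (s.erase a).powerset,
        t ^ I.card * fW t P I (s.erase a \ I) * fB t a (s.erase a)
      - ∑ a ∈ s, ∑ I ∈ (s.erase a).powerset,
        t ^ I.card * fW t P I (s.erase a \ I) * fB t a (s.erase a) * (P a * fA t a (s.erase a \ I))
      + (1 - t) * ∑ a ∈ s, ∑ I ∈ (s.erase a).powerset, ∑ k ∈ s.erase a \ I,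
        t ^ I.card * fW t P I (s.erase a \ I) * fB t a (s.erase a) *
          (P k * (k / (a - k)) * fA t k ((s.erase a \ I).erase k)) := by
    simp only [mul_sum, ← sum_sub_distrib, ← sum_add_distrib]
    refine sum_congr rfl fun a _ => sum_congr rfl fun I _ => ?_
    rw [mul_add, mul_sub, mul_one, mul_sum]
    congr 1
    refine sum_congr rfl fun k _ => ?_
    ring
  rw [hsplit, E2, E1, E3]
  simp only [mul_sum, mul_add, mul_sub, ← sum_sub_distrib, ← sum_add_distrib]
  refine sum_congr rfl fun T hT => ?_
  rw [mem_powerset] at hT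
  obtain ⟨U, hU⟩ : ∃ U, U = s \ T := ⟨_, rfl⟩
  have hd : Disjoint T U := by rw [hU]; exact disjoint_sdiff
  have hs : s = T ∪ U := by rw [hU, union_sdiff_of_subset hT]
  rw [← hU]
  have hTU : ∀ a ∈ U, a ∉ T := fun a ha h => disjoint_left.1 hd h ha
  have hUT : ∀ a ∈ T, a ∉ U := fun a ha h => disjoint_left.1 hd ha h
  have b1 : ∀ a ∈ U, fB t a (s.erase a) = fB t a T * fB t a (U.erase a) := by
    intro a ha
    rw [hs, erase_union_distrib, erase_eq_of_notMem (hTU a ha), fB_union]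
    exact hd.mono_right (erase_subset _ _)
  have b2 : ∀ a ∈ T, fB t a (s.erase a) = fB t a (T.erase a) * fB t a U := by
    intro a ha
    rw [hs, erase_union_distrib, erase_eq_of_notMem (hUT a ha), fB_union]
    exact hd.mono_left (erase_subset _ _)
  have w1 : ∀ a ∈ U, fW t P T (U.erase a) * fB t a T = fW t P T U := by
    intro a ha
    rw [← fW_insert_right _ _ _ _ _ (notMem_erase a U), insert_erase ha]
  have w2 : ∀ (V : Finset K), ∀ k ∈ T,
      t ^ (T.erase k).card * fW t P (T.erase k) V * fA t k V * P k = - fW t P T V := by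
    intro V k hk
    have := fW_insert_left t P (T.erase k) V k (notMem_erase k T)
    rw [insert_erase hk] at this
    rw [this, neg_neg]
  have c1 : ∀ a ∈ U, t ^ T.card * fW t P T (s.erase a \ T) * fB t a (s.erase a) =
      t ^ T.card * fW t P T U * fB t a (U.erase a) := by
    intro a ha
    have : s.erase a \ T = U.erase a := by rw [hU, erase_sdiff_comm]
    rw [this, b1 a ha, ← w1 a ha]; ring
  have c2 : ∀ a ∈ T, t ^ (T.erase a).card * fW t P (T.erase a) (s.erase a \ T.erase a) *
      fB t a (s.erase a) * (P a * fA t a (s.erase a \ T.erase a)) =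
      - fW t P T U * (fB t a (T.erase a) * fB t a U) := by
    intro a ha
    have : s.erase a \ T.erase a = U := by
      rw [hU]; ext z; simp only [mem_sdiff, mem_erase]
      by_cases h : z = a
      · subst h; simp [ha]
      · simp [h]
    rw [this, b2 a ha, ← w2 U a ha]; ring
  have c3 : ∀ k ∈ T, ∀ a ∈ U, t ^ (T.erase k).card * fW t P (T.erase k) (s.erase a \ T.erase k) *
      fB t a (s.erase a) * (P k * (k / (a - k)) * fA t k ((s.erase a \ T.erase k).erase k)) =
      - fW t P T U * fB t k (T.erase k) * (k / (a - k) * fB t a (U.erase a)) := by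
    intro k hk a ha
    have hka : k ≠ a := by rintro rfl; exact hTU _ ha hk
    have hk' : k ∉ U.erase a := fun h => hUT k hk (mem_of_mem_erase h)
    have : s.erase a \ T.erase k = insert k (U.erase a) := by
      rw [hU]; ext z; simp only [mem_sdiff, mem_erase, mem_insert]
      by_cases h : z = k
      · subst h; simp [hka, hT hk]
      · simp [h]; tauto
    rw [this, erase_insert hk', fW_insert_right _ _ _ _ _ hk', b1 a ha, ← w1 a ha]
    have := w2 (U.erase a) k hk
    linear_combination (fB t k (T.erase k) * fB t a T * fB t a (U.erase a) * (k / (a - k))) * this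
  have s1 : ∑ a ∈ U, t ^ T.card * fW t P T (s.erase a \ T) * fB t a (s.erase a) =
      t ^ T.card * fW t P T U * ∑ a ∈ U, fB t a (U.erase a) := by
    rw [sum_congr rfl c1, mul_sum]
  have s2 : ∑ a ∈ T, t ^ (T.erase a).card * fW t P (T.erase a) (s.erase a \ T.erase a) *
      fB t a (s.erase a) * (P a * fA t a (s.erase a \ T.erase a)) =
      - fW t P T U * ∑ a ∈ T, (fB t a (T.erase a) * fB t a U) := by
    rw [sum_congr rfl c2, mul_sum]
  have s3 : ∑ k ∈ T, ∑ a ∈ U, t ^ (T.erase k).card *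
      fW t P (T.erase k) (s.erase a \ T.erase k) *
      fB t a (s.erase a) * (P k * (k / (a - k)) * fA t k ((s.erase a \ T.erase k).erase k)) =
      - fW t P T U * ∑ k ∈ T, fB t k (T.erase k) * ∑ a ∈ U, (k / (a - k) * fB t a (U.erase a)) := by
    rw [mul_sum]
    refine sum_congr rfl fun k hk => ?_
    rw [sum_congr rfl (c3 k hk), ← mul_sum, mul_assoc]
  have s4 : ∑ a ∈ T, (fB t a (T.erase a) * fB t a U) = ∑ a ∈ T, fB t a (T.erase a) +
      (1 - t) * ∑ k ∈ T, fB t k (T.erase k) * ∑ a ∈ U, (k / (a - k) * fB t a (U.erase a)) := by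
    rw [mul_sum, ← sum_add_distrib]
    refine sum_congr rfl fun k hk => ?_
    rw [L1 t U k (hUT k hk)]; ring
  have hc : s.card = T.card + U.card := by rw [hs, card_union_of_disjoint hd]
  simp only [← mul_sum]
  rw [s1, s2, s3, s4, hc, pow_add]
  linear_combination (-fW t P T U) * L2 t T - t ^ T.card * fW t P T U * L2 t U

theorem om_rec (t : K) (ht : t ≠ 0) (s Y : Finset K) (h : ∀ x ∈ s, ∀ y ∈ Y, x ≠ t * y) :
    t ^ Y.card * ((1 - t ^ s.card) * om t s Y) = t ^ s.card * (1 - t) ^ 2 *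
      ∑ a ∈ s, ∑ b ∈ Y, b / (a - t * b) * fB t b (Y.erase b) * fQ t b (s.erase a) *
        fB t a (s.erase a) * om t (s.erase a) (Y.erase b) := by
  rw [om, step3, mul_left_comm, mul_sum]
  have key : ∀ a ∈ s, t ^ Y.card * (∑ I ∈ (s.erase a).powerset,
      t ^ I.card * fW t (fP t Y) I (s.erase a \ I) * fB t a (s.erase a) *
        (1 - fP t Y a * fA t a (s.erase a \ I) + (1 - t) * ∑ k ∈ s.erase a \ I,
          fP t Y k * (k / (a - k)) * fA t k ((s.erase a \ I).erase k))) =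
      t ^ s.card * (1 - t) * ∑ b ∈ Y, b / (a - t * b) * fB t b (Y.erase b) * fQ t b (s.erase a) *
        fB t a (s.erase a) * om t (s.erase a) (Y.erase b) := by
    intro a ha
    simp only [om, mul_sum]
    rw [sum_comm (s := Y)]
    refine sum_congr rfl fun I hI => ?_
    rw [mem_powerset] at hI
    obtain ⟨J, hJ⟩ : ∃ J, J = s.erase a \ I := ⟨_, rfl⟩
    rw [← hJ]
    have hd : Disjoint I J := by rw [hJ]; exact disjoint_sdiff
    have hs : s.erase a = I ∪ J := by rw [hJ, union_sdiff_of_subset hI]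
    have hJs : J ⊆ s.erase a := by rw [hs]; exact subset_union_right
    have l3 := L3 t ht Y J a (fun h => notMem_erase a s (hJs h)) (h a ha)
      (fun i hi => h i (mem_of_mem_erase (hJs hi)))
    have hc : s.card = I.card + (J.card + 1) := by
      have := card_erase_add_one ha
      rw [hs, card_union_of_disjoint hd] at this
      omega
    have q : ∀ b ∈ Y, t ^ s.card * (1 - t) * (b / (a - t * b) * fB t b (Y.erase b) *
        fQ t b (s.erase a) * fB t a (s.erase a) * fW t (fP t (Y.erase b)) I J) =
        (t ^ I.card * fW t (fP t Y) I J * fB t a (s.erase a)) * ((1 - t) * t ^ (J.card + 1) *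
          (b / (a - t * b) * fB t b (Y.erase b) * fQ t b J)) := by
      intro b hb
      have q1 : fQ t b (s.erase a) = fQ t b I * fQ t b J := by rw [hs, fQ, prod_union hd, fQ, fQ]
      have q2 : ∏ i ∈ I, fP t Y i = fQ t b I * ∏ i ∈ I, fP t (Y.erase b) i := by
        rw [fQ, ← prod_mul_distrib]
        refine prod_congr rfl fun i _ => ?_
        rw [fP, fP, mul_prod_erase Y (fun y => (i - y) / (i - t * y)) hb]
      rw [fW, fW, q1, q2, hc, pow_add]; ring
    rw [sum_congr rfl q]
    simp only [← mul_sum]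
    rw [l3]
    ring
  rw [sum_congr rfl key, ← mul_sum]
  ring

/-- extend a permutation by prescribing the value at the last index -/
noncomputable def extP {n : ℕ} (a : Fin (n + 1)) (ρ : Equiv.Perm (Fin n)) :
    Equiv.Perm (Fin (n + 1)) :=
  Equiv.ofBijective (Fin.snoc (α := fun _ => Fin (n + 1)) (fun i => a.succAbove (ρ i)) a) (by
    rw [← Finite.injective_iff_bijective, Fin.snoc_injective_iff]
    refine ⟨fun i j h => ?_, ?_⟩
    · exact ρ.injective (Fin.succAbove_right_injective h)
    · rintro ⟨i, hi⟩
      exact Fin.succAbove_ne a _ hi)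

theorem extP_last {n : ℕ} (a : Fin (n + 1)) (ρ : Equiv.Perm (Fin n)) :
    extP a ρ (Fin.last n) = a := by simp [extP]
theorem extP_castSucc {n : ℕ} (a : Fin (n + 1)) (ρ : Equiv.Perm (Fin n)) (i : Fin n) :
    extP a ρ i.castSucc = a.succAbove (ρ i) := by simp [extP]

theorem sum_perm_last {n : ℕ} (f : Equiv.Perm (Fin (n + 1)) → K) :
    ∑ σ, f σ = ∑ a, ∑ ρ, f (extP a ρ) := by
  rw [← Fintype.sum_prod_type']
  symm
  refine Fintype.sum_bijective (fun p : Fin (n + 1) × Equiv.Perm (Fin n) => extP p.1 p.2) ?_ _ _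
    (fun _ => rfl)
  rw [Fintype.bijective_iff_injective_and_card]
  constructor
  · rintro ⟨a, ρ⟩ ⟨b, π⟩ h
    simp only at h
    have h1 : a = b := by rw [← extP_last a ρ, h, extP_last]
    subst h1
    congr 1
    ext i
    have : extP a ρ i.castSucc = extP a π i.castSucc := by rw [h]
    rw [extP_castSucc, extP_castSucc] at this
    rw [Fin.succAbove_right_injective this]
  · simp [Fintype.card_perm, Nat.factorial_succ]

theorem prod_Ioi_castSucc {n : ℕ} (i : Fin n) (f : Fin (n + 1) → K) :
    ∏ j ∈ Ioi i.castSucc, f j = (∏ j ∈ Ioi i, f j.castSucc) * f (Fin.last n) := by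
  have h1 : ∀ (k : ℕ) (i : Fin k) (g : Fin k → K),
      ∏ j ∈ Ioi i, g j = ∏ j, if i < j then g j else 1 := by
    intro k i g
    rw [← prod_filter]
    refine prod_congr ?_ fun _ _ => rfl
    ext; simp
  rw [h1, h1, Fin.prod_univ_castSucc]
  simp [Fin.castSucc_lt_last]

theorem prod_pairs_succ {n : ℕ} (g : Fin (n + 1) → Fin (n + 1) → K) :
    ∏ i, ∏ j ∈ Ioi i, g i j = (∏ i : Fin n, ∏ j ∈ Ioi i, g i.castSucc j.castSucc) *
      ∏ i : Fin n, g i.castSucc (Fin.last n) := by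
  rw [Fin.prod_univ_castSucc, ← prod_mul_distrib]
  have : Ioi (Fin.last n) = ∅ := by
    ext j; simp [Fin.le_last]
  rw [this, prod_empty, mul_one]
  exact prod_congr rfl fun i _ => prod_Ioi_castSucc i _

theorem iota_castSucc {m n : ℕ} (h : m ≤ n) (h' : m + 1 ≤ n + 1) (i : Fin m) :
    iotaMap (m + 1) (n + 1) h' i.castSucc = (iotaMap m n h i).castSucc := by
  apply Fin.ext; simp [iotaMap]
theorem iota_last {m n : ℕ} (h' : m + 1 ≤ n + 1) :
    iotaMap (m + 1) (n + 1) h' (Fin.last m) = Fin.last n := by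
  apply Fin.ext; simp [iotaMap]

/-- y part -/
noncomputable def fY {n : ℕ} (t : K) (y : Fin n → K) : K :=
  ∏ i : Fin n, ∏ j ∈ Finset.Ioi i, (y i - t * y j) / (y i - y j)

/-- summand -/
noncomputable def fG {m n : ℕ} (hmn : m ≤ n) (t : K) (x : Fin m → K) (y : Fin n → K) : K :=
  (∏ i : Fin m, y (iotaMap m n hmn i) / (x i - t * y (iotaMap m n hmn i))) * fY t y *
  (∏ i : Fin m, ∏ j ∈ Finset.Ioi i,
    ((x i - y (iotaMap m n hmn j)) / (x i - t * y (iotaMap m n hmn j))) *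
      ((x i - t * x j) / (x i - x j)))

/-- sum -/
noncomputable def fR {m n : ℕ} (hmn : m ≤ n) (t : K) (x : Fin m → K) (y : Fin n → K) : K :=
  ∑ σ : Equiv.Perm (Fin m), ∑ τ : Equiv.Perm (Fin n), fG hmn t (x ∘ σ) (y ∘ τ)

theorem fY_succ {n : ℕ} (t : K) (v : Fin (n + 1) → K) :
    fY t v = fY t (v ∘ Fin.castSucc) *
      ∏ i : Fin n, (v i.castSucc - t * v (Fin.last n)) / (v i.castSucc - v (Fin.last n)) :=
  prod_pairs_succ _

theorem fG_succ {m n : ℕ} (h : m ≤ n) (h' : m + 1 ≤ n + 1) (t : K) (u : Fin (m + 1) → K)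
    (v : Fin (n + 1) → K) :
    fG h' t u v = (v (Fin.last n) / (u (Fin.last m) - t * v (Fin.last n)) *
      (∏ i : Fin n, (v i.castSucc - t * v (Fin.last n)) / (v i.castSucc - v (Fin.last n))) *
      (∏ i : Fin m, (u i.castSucc - v (Fin.last n)) / (u i.castSucc - t * v (Fin.last n))) *
      (∏ i : Fin m, (u i.castSucc - t * u (Fin.last m)) / (u i.castSucc - u (Fin.last m)))) *
      fG h t (u ∘ Fin.castSucc) (v ∘ Fin.castSucc) := by
  rw [fG, prod_pairs_succ, fY_succ, Fin.prod_univ_castSucc, fG]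
  simp only [iota_castSucc h h', iota_last, prod_mul_distrib, Function.comp]
  ring

theorem image_succAbove {n : ℕ} (x : Fin (n + 1) → K) (hx : Function.Injective x)
    (a : Fin (n + 1)) :
    univ.image (x ∘ a.succAbove) = (univ.image x).erase (x a) := by
  ext z
  simp only [mem_image, mem_univ, true_and, mem_erase, Function.comp]
  constructor
  · rintro ⟨i, rfl⟩
    exact ⟨fun h => Fin.succAbove_ne a i (hx h), _, rfl⟩
  · rintro ⟨h, i, rfl⟩
    obtain ⟨j, hj⟩ := Fin.exists_succAbove_eq (x := i) (y := a) (by rintro rfl; exact h rfl)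
    exact ⟨j, by rw [hj]⟩

theorem prod_succAbove {n : ℕ} (x : Fin (n + 1) → K) (hx : Function.Injective x)
    (a : Fin (n + 1)) (ρ : Equiv.Perm (Fin n)) (g : K → K) :
    ∏ i, g (x (a.succAbove (ρ i))) = ∏ z ∈ (univ.image x).erase (x a), g z := by
  rw [← image_succAbove x hx, prod_image, Equiv.prod_comp ρ (fun i => g (x (a.succAbove i)))]
  · rfl
  · intro i _ j _ h
    exact Fin.succAbove_right_injective (hx h)

theorem fR_succ {m n : ℕ} (h : m ≤ n) (h' : m + 1 ≤ n + 1) (t : K) (x : Fin (m + 1) → K)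
    (y : Fin (n + 1) → K) (hx : Function.Injective x) (hy : Function.Injective y) :
    fR h' t x y = ∑ a, ∑ b, (y b / (x a - t * y b) * fB t (y b) ((univ.image y).erase (y b)) *
      fQ t (y b) ((univ.image x).erase (x a)) * fB t (x a) ((univ.image x).erase (x a))) *
      fR h t (x ∘ a.succAbove) (y ∘ b.succAbove) := by
  rw [fR, sum_perm_last]
  refine sum_congr rfl fun a _ => ?_
  simp_rw [sum_perm_last (n := n)]
  rw [sum_comm]
  refine sum_congr rfl fun b _ => ?_
  rw [fR, mul_sum]
  refine sum_congr rfl fun ρ _ => ?_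
  rw [mul_sum]
  refine sum_congr rfl fun π _ => ?_
  rw [fG_succ h]
  have e1 : (x ∘ extP a ρ) ∘ Fin.castSucc = (x ∘ a.succAbove) ∘ ρ := by
    funext i; simp [extP_castSucc]
  have e2 : (y ∘ extP b π) ∘ Fin.castSucc = (y ∘ b.succAbove) ∘ π := by
    funext i; simp [extP_castSucc]
  rw [e1, e2]
  simp only [Function.comp_apply, extP_last, extP_castSucc]
  rw [prod_succAbove y hy b π (fun z => (z - t * y b) / (z - y b)),
    prod_succAbove x hx a ρ (fun z => (z - y b) / (z - t * y b)),
    prod_succAbove x hx a ρ (fun z => (z - t * x a) / (z - x a))]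
  rfl

theorem sumY (t : K) (n : ℕ) : ∀ (y : Fin n → K), Function.Injective y →
    (1 - t) ^ n * ∑ τ : Equiv.Perm (Fin n), fY t (y ∘ τ) =
      ∏ i ∈ range n, (1 - t ^ (i + 1)) := by
  induction n with
  | zero => intro y _; simp [fY]
  | succ n ih =>
    intro y hy
    rw [sum_perm_last]
    have : ∀ b, (1 - t) ^ n * ∑ π, fY t (y ∘ extP b π) =
        fB t (y b) ((univ.image y).erase (y b)) * ∏ i ∈ range n, (1 - t ^ (i + 1)) := by
      intro b
      rw [← ih (y ∘ b.succAbove) (hy.comp Fin.succAbove_right_injective), mul_left_comm]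
      congr 1
      rw [mul_sum]
      refine sum_congr rfl fun π _ => ?_
      have e2 : (y ∘ extP b π) ∘ Fin.castSucc = (y ∘ b.succAbove) ∘ π := by
        funext i; simp [extP_castSucc]
      rw [fY_succ, e2]
      simp only [Function.comp_apply, extP_last, extP_castSucc]
      rw [prod_succAbove y hy b π (fun z => (z - t * y b) / (z - y b)), mul_comm]
      rfl
    rw [pow_succ', mul_assoc, mul_sum, sum_congr rfl fun b _ => this b, ← sum_mul, prod_range_succ]
    have l2 := L2 t (univ.image y)
    rw [sum_image (fun i _ j _ h => hy h), card_image_of_injective _ hy, card_univ,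
      Fintype.card_fin] at l2
    rw [← mul_assoc, l2, mul_comm]

theorem om_eq {m n : ℕ} (t : K) (x : Fin m → K) (y : Fin n → K) (hx : Function.Injective x)
    (hy : Function.Injective y) : bisymOmega t x y = om t (univ.image x) (univ.image y) := by
  rw [bisymOmega, om]
  refine sum_bij (fun I _ => I.image x) ?_ ?_ ?_ ?_
  · intro I _
    rw [mem_powerset]
    exact image_subset_image (subset_univ _)
  · intro I _ J _ h
    exact image_injective hx h
  · intro T hT
    rw [mem_powerset] at hT
    obtain ⟨I, _, hI⟩ := subset_image_iff.1 hT
    exact ⟨I, mem_univ _, hI⟩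
  · intro I _
    have hc : univ.image x \ I.image x = Iᶜ.image x := by
      rw [← image_sdiff _ _ hx, compl_eq_univ_sdiff]
    rw [fW, hc, card_image_of_injective _ hx, prod_image (fun i _ j _ h => hx h),
      prod_image (fun i _ j _ h => hx h)]
    simp only [fA, fP]
    congr 1
    · congr 1
      refine prod_congr rfl fun i _ => ?_
      rw [prod_image (fun i _ j _ h => hx h)]
    · refine prod_congr rfl fun i _ => ?_
      rw [prod_image (fun i _ j _ h => hy h)]

theorem main_aux (t : K) (ht : t ≠ 0) (m : ℕ) : ∀ (n : ℕ) (hmn : m ≤ n)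
    (_ : ∀ i : ℕ, 1 ≤ i → i ≤ max m (n - m) → t ^ i ≠ 1)
    (x : Fin m → K) (y : Fin n → K)
    (_ : Function.Injective x) (_ : Function.Injective y)
    (_ : ∀ (i : Fin m) (j : Fin n), x i ≠ t * y j),
    om t (univ.image x) (univ.image y) =
      t ^ ((m : ℤ) * ((m : ℤ) - (n : ℤ))) * (1 - t) ^ (n + m) /
        ((∏ i ∈ Finset.range (n - m), (1 - t ^ (i + 1))) *
          (∏ i ∈ Finset.range m, (1 - t ^ (i + 1)))) * fR hmn t x y := by
  induction m with
  | zero =>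
    intro n hmn ht1 x y hx hy hxy
    have h1 : fR hmn t x y = ∑ τ : Equiv.Perm (Fin n), fY t (y ∘ τ) := by
      simp [fR, fG]
    have h2 := sumY t n y hy
    have h3 : ∏ i ∈ range n, (1 - t ^ (i + 1)) ≠ 0 := by
      rw [prod_ne_zero_iff]
      intro i hi
      rw [mem_range] at hi
      exact sub_ne_zero.2 (ht1 (i + 1) (by omega) (by simp; omega)).symm
    have h4 : om t (univ.image x) (univ.image y) = 1 := by
      simp [om, fW]
    rw [h1, h4]
    simp only [Nat.cast_zero, zero_mul, zpow_zero, one_mul, Nat.sub_zero, range_zero, prod_empty,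
      mul_one, Nat.add_zero]
    rw [div_mul_eq_mul_div, h2, div_self h3]
  | succ m ih =>
    intro n' hmn ht1 x y hx hy hxy
    obtain ⟨n, rfl⟩ : ∃ n, n' = n + 1 := ⟨n' - 1, by omega⟩
    have h : m ≤ n := by omega
    rw [Nat.add_sub_add_right] at ht1 ⊢
    have hm : 1 - t ^ (m + 1) ≠ 0 := sub_ne_zero.2 (ht1 (m + 1) (by omega) (by simp)).symm
    have ih' : ∀ a b, om t ((univ.image x).erase (x a)) ((univ.image y).erase (y b)) =
        t ^ ((m : ℤ) * ((m : ℤ) - (n : ℤ))) * (1 - t) ^ (n + m) /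
        ((∏ i ∈ Finset.range (n - m), (1 - t ^ (i + 1))) *
          (∏ i ∈ Finset.range m, (1 - t ^ (i + 1)))) *
          fR h t (x ∘ a.succAbove) (y ∘ b.succAbove) :=
      fun a b => by
        rw [← image_succAbove x hx, ← image_succAbove y hy]
        exact ih n h (fun i h1 h2 => ht1 i h1 (h2.trans (by simp; omega)))
          (x ∘ a.succAbove) (y ∘ b.succAbove) (hx.comp Fin.succAbove_right_injective)
          (hy.comp Fin.succAbove_right_injective) (fun i j => hxy _ _)
    have rec1 := om_rec t ht (univ.image x) (univ.image y) (by
      intro a ha b hb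
      simp only [mem_image, mem_univ, true_and] at ha hb
      obtain ⟨i, rfl⟩ := ha
      obtain ⟨j, rfl⟩ := hb
      exact hxy i j)
    simp only [sum_image (s := (univ : Finset (Fin (m + 1)))) (fun i _ j _ h => hx h),
      sum_image (s := (univ : Finset (Fin (n + 1)))) (fun i _ j _ h => hy h),
      card_image_of_injective _ hx, card_image_of_injective _ hy, card_univ, Fintype.card_fin,
      ih'] at rec1
    set c := t ^ ((m : ℤ) * ((m : ℤ) - (n : ℤ))) * (1 - t) ^ (n + m) /
        ((∏ i ∈ Finset.range (n - m), (1 - t ^ (i + 1))) *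
          (∏ i ∈ Finset.range m, (1 - t ^ (i + 1)))) with hc
    have hsum : ∑ a, ∑ b, y b / (x a - t * y b) * fB t (y b) ((univ.image y).erase (y b)) *
      fQ t (y b) ((univ.image x).erase (x a)) * fB t (x a) ((univ.image x).erase (x a)) *
      (c * fR h t (x ∘ a.succAbove) (y ∘ b.succAbove)) = c * fR hmn t x y := by
      rw [fR_succ h hmn t x y hx hy, mul_sum]
      refine sum_congr rfl fun a _ => ?_
      rw [mul_sum]
      refine sum_congr rfl fun b _ => ?_
      ring
    rw [hsum] at rec1
    have hz : t ^ (((m + 1 : ℕ) : ℤ) * (((m + 1 : ℕ) : ℤ) - ((n + 1 : ℕ) : ℤ))) * t ^ (n + 1) =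
        t ^ ((m : ℤ) * ((m : ℤ) - (n : ℤ))) * t ^ (m + 1) := by
      rw [← zpow_natCast t (n + 1), ← zpow_natCast t (m + 1), ← zpow_add₀ ht, ← zpow_add₀ ht]
      congr 1
      push_cast
      ring
    have htn : t ^ (n + 1) ≠ 0 := pow_ne_zero _ ht
    apply mul_left_cancel₀ (mul_ne_zero htn hm)
    rw [mul_assoc, rec1, prod_range_succ, hc]
    have h5 : (1 - t) ^ (n + 1 + (m + 1)) = (1 - t) ^ (n + m) * (1 - t) ^ 2 := by
      rw [← pow_add]; congr 1; omega
    rw [h5]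
    generalize (∏ i ∈ Finset.range (n - m), (1 - t ^ (i + 1))) = A
    generalize (∏ i ∈ Finset.range m, (1 - t ^ (i + 1))) = B
    have h6 : ∀ z w : K, t ^ (n + 1) * (1 - t ^ (m + 1)) *
        (z * w / (A * (B * (1 - t ^ (m + 1)))) * fR hmn t x y) =
        (z * t ^ (n + 1)) * w * (fR hmn t x y) * (A⁻¹ * B⁻¹) := by
      intro z w
      have : (1 - t ^ (m + 1)) * (1 - t ^ (m + 1))⁻¹ = 1 := mul_inv_cancel₀ hm
      rw [div_eq_mul_inv, mul_inv, mul_inv]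
      linear_combination (t ^ (n + 1) * z * w * A⁻¹ * B⁻¹ * fR hmn t x y) * this
    rw [h6, hz, div_eq_mul_inv, mul_inv]
    ring

end
end BisymAux

/-- The fully symmetrized expression for `ω(x,y;t)` (Proposition 3.6). -/
theorem bisymOmega_fully_symmetrized {K : Type*} [Field K] {m n : ℕ} (hmn : m ≤ n)
    (t : K) (ht : t ≠ 0)
    (ht1 : ∀ i : ℕ, 1 ≤ i → i ≤ max m (n - m) → t ^ i ≠ 1)
    (x : Fin m → K) (y : Fin n → K)
    (hx : Function.Injective x) (hy : Function.Injective y)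
    (hxy : ∀ (i : Fin m) (j : Fin n), x i ≠ t * y j) :
    bisymOmega t x y =
      t ^ ((m : ℤ) * ((m : ℤ) - (n : ℤ))) * (1 - t) ^ (n + m) /
        ((∏ i ∈ Finset.range (n - m), (1 - t ^ (i + 1))) *
          (∏ i ∈ Finset.range m, (1 - t ^ (i + 1)))) *
      ∑ σ : Equiv.Perm (Fin m), ∑ τ : Equiv.Perm (Fin n),
        (∏ i : Fin m,
          y (τ (iotaMap m n hmn i)) / (x (σ i) - t * y (τ (iotaMap m n hmn i)))) *
        (∏ i : Fin n, ∏ j ∈ Finset.Ioi i,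
          (y (τ i) - t * y (τ j)) / (y (τ i) - y (τ j))) *
        (∏ i : Fin m, ∏ j ∈ Finset.Ioi i,
          ((x (σ i) - y (τ (iotaMap m n hmn j))) /
              (x (σ i) - t * y (τ (iotaMap m n hmn j)))) *
          ((x (σ i) - t * x (σ j)) / (x (σ i) - x (σ j)))) := by
  classical
  rw [BisymAux.om_eq t x y hx hy, BisymAux.main_aux t ht m n hmn ht1 x y hx hy hxy]
  rfl
end

section
/- Let m, n be integers with 0 ≤ m ≤ n, let x = (x_1, …, x_m) ∈ ℂ^m have pairwise distinct entries, let y = (y_1, …, y_n) ∈ ℂ^n have pairwise distinct entries, and assume x_i ≠ y_j for all 1 ≤ i ≤ m, 1 ≤ j ≤ n. Then the function t ↦ ω(x, y; t)/(1 − t)^m tends, as t → 1 with t ≠ 1, to (−1)^m · Σ ∏_{i=1}^{m} y_{l_i}/(y_{l_i} − x_i), where the sum is over all tuples (l_1, …, l_m) of pairwise distinct indices in {1, …, n}. -/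
open Finset Filter

open Polynomial in
lemma divW {m : ℕ} (x : Fin (m+1) → ℂ) (z : ℂ) :
    ∃ P : ℂ[X], P.Monic ∧ P.natDegree = m ∧ ∀ i,
      P.eval (x i) = ∏ j, (z - x (i.succAbove j)) ∧
      P.eval (x i) + (x i - z) * (derivative P).eval (x i) = ∏ j, (x i - x (i.succAbove j)) := by
  set W : ℂ[X] := ∏ i, (X - C (x i)) with hW
  have hWm : W.Monic := monic_prod_of_monic _ _ (fun i _ => monic_X_sub_C _)
  have hWd : W.natDegree = m + 1 := by
    rw [hW, natDegree_prod_of_monic _ _ (fun i _ => monic_X_sub_C _)]; simp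
  have hq : C (W.eval z) + (X - C z) * (W /ₘ (X - C z)) = W := by
    rw [← modByMonic_X_sub_C_eq_C_eval]; exact modByMonic_add_div _ _
  have hWi : ∀ i, W = (X - C (x i)) * ∏ j, (X - C (x (i.succAbove j))) := fun i => by
    rw [hW, Fin.prod_univ_succAbove _ i]
  have hWz : ∀ i, W.eval z = (z - x i) * ∏ j, (z - x (i.succAbove j)) := fun i => by
    rw [hWi i]; simp [eval_prod]
  have hWd' : ∀ i, (derivative W).eval (x i) = ∏ j, (x i - x (i.succAbove j)) := fun i => by
    rw [hWi i]; simp [eval_prod, derivative_mul]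
  have hD : ∀ i, (W /ₘ (X - C z)).eval (x i) + (x i - z) * (derivative (W /ₘ (X - C z))).eval (x i)
      = ∏ j, (x i - x (i.succAbove j)) := fun i => by
    rw [← hWd' i]
    conv_rhs => rw [← hq]
    simp [derivative_mul]
  refine ⟨W /ₘ (X - C z), ?_, ?_, fun i => ⟨?_, hD i⟩⟩
  · rw [Monic, leadingCoeff_divByMonic_of_monic (monic_X_sub_C z), hWm]
    rw [degree_X_sub_C, degree_eq_natDegree hWm.ne_zero, hWd]
    exact_mod_cast Nat.le_add_left 1 m
  · rw [natDegree_divByMonic _ (monic_X_sub_C z), hWd]; simp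
  · by_cases h : x i = z
    · have := hD i
      rw [h] at this ⊢
      simpa using this
    · have h1 := congrArg (eval (x i)) hq
      have h0 : W.eval (x i) = 0 := by rw [hWi i]; simp
      simp only [eval_add, eval_mul, eval_sub, eval_X, eval_C, h0, hWz i] at h1
      have : x i - z ≠ 0 := sub_ne_zero.2 h
      apply mul_left_cancel₀ this
      linear_combination h1

noncomputable def Dt {m : ℕ} (x q : Fin m → ℂ) : ℂ :=
  (Matrix.of fun i k : Fin m => x i ^ (k:ℕ) * (q i - ((m:ℂ) - 1 - (k:ℕ)))).det

lemma colExp {m : ℕ} (x : Fin (m+1) → ℂ) (y : ℂ) (M : Matrix (Fin (m+1)) (Fin (m+1)) ℂ)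
    (N : Matrix (Fin (m+1)) (Fin m) ℂ)
    (h : ∀ i (k : Fin m), M i k.succ - y * M i k.castSucc = (x i - y) * N i k) :
    M.det = ∑ i : Fin (m+1), (-1)^(i:ℕ) * M i 0 * ((∏ j, (x (i.succAbove j) - y)) *
      (N.submatrix i.succAbove id).det) := by
  have := Matrix.det_eq_of_forall_col_eq_smul_add_pred (A := M)
    (B := Matrix.of fun i => Fin.cons (M i 0) (fun k => (x i - y) * N i k)) (fun _ => y)
    (fun i => by simp) (fun i k => by simp [← h])
  rw [this, Matrix.det_succ_column_zero]
  refine Finset.sum_congr rfl fun i _ => ?_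
  rw [← Matrix.det_mul_column]
  simp
  left
  rfl

lemma kill0 {m : ℕ} (N : Matrix (Fin (m+1)) (Fin m) ℂ) (k : Fin m) :
    ∑ i : Fin (m+1), (-1)^(i:ℕ) * N i k * (N.submatrix i.succAbove id).det = 0 := by
  have := Matrix.det_succ_column_zero (Matrix.of fun i => (Fin.cons (N i k) (N i) : Fin (m+1) → ℂ))
  rw [Matrix.det_zero_of_column_eq (i := 0) (j := k.succ) (Fin.succ_ne_zero k).symm (by simp)] at this
  rw [this]
  refine Finset.sum_congr rfl fun i _ => ?_
  simp
  left
  rfl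

open Polynomial in
lemma kill {m : ℕ} (x q : Fin (m+1) → ℂ) (Q : ℂ[X]) (hQ : Q.degree < m) :
    ∑ i : Fin (m+1), (-1)^(i:ℕ) * ((q i - ((m:ℂ) - 1)) * Q.eval (x i) +
      x i * (derivative Q).eval (x i)) * Dt (x ∘ i.succAbove) (q ∘ i.succAbove) = 0 := by
  have key : ∀ i, (q i - ((m:ℂ) - 1)) * Q.eval (x i) + x i * (derivative Q).eval (x i)
      = ∑ k : Fin m, Q.coeff k * (x i ^ (k:ℕ) * (q i - ((m:ℂ) - 1 - (k:ℕ)))) := fun i => by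
    have hs : Q = ∑ k : Fin m, C (Q.coeff k) * X ^ (k:ℕ) := by
      rw [Fin.sum_univ_eq_sum_range (fun k => C (Q.coeff k) * X ^ k) m]
      by_cases h0 : m = 0
      · subst h0
        simpa using hQ
      · exact Q.as_sum_range_C_mul_X_pow' (by
          by_cases hz : Q = 0
          · subst hz; simpa using Nat.pos_of_ne_zero h0
          · exact (natDegree_lt_iff_degree_lt hz).2 hQ)
    conv_lhs => rw [hs]
    simp only [eval_finsetSum, derivative_sum, Finset.mul_sum, ← Finset.sum_add_distrib]
    refine Finset.sum_congr rfl fun k _ => ?_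
    rcases k with ⟨k, hk⟩
    cases k with
    | zero => simp; ring
    | succ k =>
      simp only [eval_mul, eval_C, eval_pow, eval_X, derivative_C_mul_X_pow, Nat.add_sub_cancel]
      push_cast
      ring
  simp_rw [key, Finset.mul_sum, Finset.sum_mul]
  rw [Finset.sum_comm]
  refine Finset.sum_eq_zero fun k _ => ?_
  have := kill0 (Matrix.of fun (i : Fin (m+1)) (k : Fin m) => x i ^ (k:ℕ) * (q i - ((m:ℂ) - 1 - (k:ℕ)))) k
  have h2 := congrArg (fun z => Q.coeff k * z) this
  simp only [mul_zero, Finset.mul_sum] at h2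
  rw [← h2]
  refine Finset.sum_congr rfl fun i _ => ?_
  have : Dt (x ∘ i.succAbove) (q ∘ i.succAbove) = ((Matrix.of fun (i : Fin (m+1)) (k : Fin m) => x i ^ (k:ℕ) * (q i - ((m:ℂ) - 1 - (k:ℕ)))).submatrix i.succAbove id).det := rfl
  rw [this]
  simp only [Matrix.of_apply]
  ring

lemma negprod {m : ℕ} (f : Fin m → ℂ) (y : ℂ) : ∏ j, (f j - y) = (-1)^m * ∏ j, (y - f j) := by
  have : ∀ j, f j - y = (-1) * (y - f j) := fun j => by ring
  simp_rw [this, Finset.prod_mul_distrib]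
  simp

lemma step {m : ℕ} (x q : Fin (m+1) → ℂ) (y : ℂ) (hy : ∀ i, x i ≠ y) :
    Dt x (fun i => y / (y - x i) + q i) = Dt x q + ∑ i : Fin (m+1), y / (y - x i) *
      ((-1)^(i:ℕ) * (∏ j, (x (i.succAbove j) - x i)) * Dt (x ∘ i.succAbove) (q ∘ i.succAbove)) := by
  obtain ⟨P, hPm, hPd, hP⟩ := divW x y
  obtain ⟨R, hRm, hRd, hR⟩ := divW x 0
  have hlt : (P - R).degree < (m:ℕ) := by
    have := Polynomial.degree_sub_lt_left (p := P) (q := R) (by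
      rw [Polynomial.degree_eq_natDegree hPm.ne_zero, Polynomial.degree_eq_natDegree hRm.ne_zero, hPd, hRd])
      hPm.ne_zero (by rw [hPm, hRm])
    rwa [Polynomial.degree_eq_natDegree hPm.ne_zero, hPd] at this
  have hk := kill x q (P - R) hlt
  have e1 : Dt x (fun i => y / (y - x i) + q i) = _ := colExp x y _ (Matrix.of fun (i : Fin (m+1)) (k : Fin m) => x i ^ (k:ℕ) * (q i - ((m:ℂ) - 1 - (k:ℕ)))) (fun i k => by
    have : y - x i ≠ 0 := sub_ne_zero.2 (hy i).symm
    simp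
    field_simp
    ring)
  have e2 : Dt x q = _ := colExp x 0 _ (Matrix.of fun (i : Fin (m+1)) (k : Fin m) => x i ^ (k:ℕ) * (q i - ((m:ℂ) - 1 - (k:ℕ)))) (fun i k => by
    simp
    ring)
  have hE : ∀ i : Fin (m+1), ((Matrix.of fun (i : Fin (m+1)) (k : Fin m) => x i ^ (k:ℕ) * (q i - ((m:ℂ) - 1 - (k:ℕ)))).submatrix i.succAbove id).det = Dt (x ∘ i.succAbove) (q ∘ i.succAbove) := fun i => rfl
  have hk2 := congrArg (fun z => (-1)^m * z) hk
  rw [e1, e2, ← sub_eq_zero, ← Finset.sum_add_distrib, ← Finset.sum_sub_distrib]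
  simp only [mul_zero, Finset.mul_sum] at hk2
  refine Eq.trans ?_ hk2
  refine Finset.sum_congr rfl fun i _ => ?_
  rw [hE]
  simp only [negprod _ y, negprod _ (0:ℂ), negprod _ (x i), ← (hP i).1, ← (hR i).1]
  rw [← (hP i).2]
  have h3 := (hP i).2.trans (hR i).2.symm
  have : y - x i ≠ 0 := sub_ne_zero.2 (hy i).symm
  simp only [Matrix.of_apply, Polynomial.eval_sub, Polynomial.derivative_sub]
  set A := Polynomial.eval (x i) P
  set A' := Polynomial.eval (x i) (Polynomial.derivative P)
  set B := Polynomial.eval (x i) R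
  set B' := Polynomial.eval (x i) (Polynomial.derivative R)
  have hB : x i * B' = A + (x i - y) * A' - B := by linear_combination -h3
  rw [mul_sub (x i), hB]
  simp
  field_simp
  ring

lemma vand {m : ℕ} (x : Fin (m+1) → ℂ) (r : Fin (m+1)) :
    (Matrix.vandermonde x).det = (-1)^(r:ℕ) * (∏ j, (x (r.succAbove j) - x r)) *
      (Matrix.vandermonde (x ∘ r.succAbove)).det := by
  rw [colExp x (x r) (Matrix.vandermonde x) (Matrix.of fun i k => x i ^ (k:ℕ)) (fun i k => by
    simp [Matrix.vandermonde_apply]; ring)]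
  rw [Finset.sum_eq_single r]
  · simp [mul_assoc, Matrix.vandermonde_apply]
    left; rfl
  · intro i _ hi
    obtain ⟨j, hj⟩ := Fin.exists_succAbove_eq hi.symm
    rw [Finset.prod_eq_zero (i := j) (Finset.mem_univ _) (by simp [hj])]
    simp
  · simp

lemma embsum {m n : ℕ} (a : Fin (m+1) → Fin (n+1) → ℂ) :
    ∑ l : Fin (m+1) ↪ Fin (n+1), ∏ i, a i (l i) =
      ∑ l : Fin (m+1) ↪ Fin n, ∏ i, a i (l i).succ +
      ∑ i, a i 0 * ∑ l : Fin m ↪ Fin n, ∏ j, a (i.succAbove j) (l j).succ := by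
  let F : (Fin (m+1) ↪ Fin n) ⊕ (Fin (m+1) × (Fin m ↪ Fin n)) → (Fin (m+1) ↪ Fin (n+1)) :=
    Sum.elim (fun e => e.trans (Fin.succEmb n)) (fun p => 
      ⟨Fin.insertNth (α := fun _ => Fin (n+1)) p.1 0 (fun j => (p.2 j).succ), by
        intro u v
        induction u using Fin.succAboveCases p.1 <;> induction v using Fin.succAboveCases p.1 <;>
        simp [Fin.succ_ne_zero, (Fin.succ_ne_zero _).symm]⟩)
  have hL : ∀ e u, F (Sum.inl e) u = (e u).succ := fun e u => rfl
  have hR0 : ∀ i e, F (Sum.inr (i, e)) i = 0 := fun i e => by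
    change Fin.insertNth (α := fun _ => Fin (n+1)) i 0 (fun j => (e j).succ) i = 0
    simp
  have hR1 : ∀ i e j, F (Sum.inr (i, e)) (i.succAbove j) = (e j).succ := fun i e j => by
    change Fin.insertNth (α := fun _ => Fin (n+1)) i 0 (fun j => (e j).succ) (i.succAbove j) = _
    simp
  clear_value F
  have hF : Function.Bijective F := by
    constructor
    · rintro (e | ⟨i, e⟩) (e' | ⟨i', e'⟩) h
      · congr 1
        ext u
        have := DFunLike.congr_fun h u
        rw [hL, hL] at this
        rw [Fin.succ_injective _ this]
      · exfalso
        have := DFunLike.congr_fun h i'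
        rw [hL, hR0] at this
        exact Fin.succ_ne_zero _ this
      · exfalso
        have := DFunLike.congr_fun h i
        rw [hL, hR0] at this
        exact Fin.succ_ne_zero _ this.symm
      · have hi : i = i' := by
          by_contra hne
          obtain ⟨j, hj⟩ := Fin.exists_succAbove_eq hne
          have := DFunLike.congr_fun h i
          rw [hR0, ← hj, hR1] at this
          exact Fin.succ_ne_zero _ this.symm
        subst hi
        congr 2
        ext j
        have := DFunLike.congr_fun h (i.succAbove j)
        rw [hR1, hR1] at this
        rw [Fin.succ_injective _ this]
    · intro l
      by_cases h : ∃ i, l i = 0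
      · obtain ⟨i, hi⟩ := h
        have hne : ∀ j, l (i.succAbove j) ≠ 0 := fun j hj =>
          Fin.succAbove_ne i j (l.injective (hj.trans hi.symm))
        refine ⟨Sum.inr (i, ⟨fun j => (l (i.succAbove j)).pred (hne j), ?_⟩), ?_⟩
        · intro u v huv
          simpa using huv
        · refine DFunLike.ext _ _ fun u => ?_
          induction u using Fin.succAboveCases i
          · rw [hR0, hi]
          · rw [hR1]
            exact Fin.succ_pred _ (hne _)
      · push Not at h
        refine ⟨Sum.inl ⟨fun j => (l j).pred (h j), ?_⟩, ?_⟩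
        · intro u v huv
          simpa using huv
        · refine DFunLike.ext _ _ fun u => ?_
          rw [hL]
          exact Fin.succ_pred _ (h _)
  rw [← hF.sum_comp, Fintype.sum_sum_type, Fintype.sum_prod_type]
  simp_rw [hL]
  congr 1
  refine Finset.sum_congr rfl fun i _ => ?_
  rw [Finset.mul_sum]
  refine Finset.sum_congr rfl fun l _ => ?_
  rw [Fin.prod_univ_succAbove _ i]
  simp [hR0, hR1]

lemma mainId {n : ℕ} : ∀ {m : ℕ} (x : Fin m → ℂ) (y : Fin n → ℂ) (_ : ∀ i j, x i ≠ y j),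
    (Matrix.vandermonde x).det * ∑ l : Fin m ↪ Fin n, ∏ i : Fin m, y (l i) / (y (l i) - x i) =
      Dt x (fun i => ∑ j, y j / (y j - x i)) := by
  induction n with
  | zero =>
    intro m x y h
    cases m with
    | zero => simp [Dt]
    | succ m =>
      have : IsEmpty (Fin (m+1) ↪ Fin 0) := ⟨fun l => (l 0).elim0⟩
      rw [Finset.univ_eq_empty (α := Fin (m+1) ↪ Fin 0), Finset.sum_empty, mul_zero]
      symm
      simp only [Finset.univ_eq_empty, Finset.sum_empty]
      apply Matrix.det_eq_zero_of_column_eq_zero (Fin.last m)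
      intro i; simp
  | succ n ih =>
    intro m x y h
    cases m with
    | zero => simp [Dt]
    | succ m =>
      rw [embsum (fun i j => y j / (y j - x i))]
      simp_rw [Fin.sum_univ_succ (n := n)]
      rw [step x _ (y 0) (fun i => h i 0), mul_add]
      rw [ih x (fun j => y j.succ) (fun i j => h i _), Finset.mul_sum]
      congr 1
      refine Finset.sum_congr rfl fun i _ => ?_
      have := ih (x ∘ i.succAbove) (fun j => y j.succ) (fun i j => h _ _)
      rw [vand x i]
      simp only [Function.comp_def] at this ⊢
      rw [← this]
      ring

lemma pairCount {m : ℕ} (S : Finset (Fin m)) :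
    ∑ i : Fin m, ∑ j ∈ Finset.Ioi i, (if i ∈ S ∧ j ∈ S then 1 else 0) = S.card.choose 2 := by
  have h := Finset.sum_sum_Ioi_add_eq_sum_sum_off_diag
    (fun i j : Fin m => if i ∈ S ∧ j ∈ S then 1 else 0)
  have h2 : ∑ i : Fin m, ∑ j ∈ ({i}ᶜ : Finset (Fin m)), (if j ∈ S ∧ i ∈ S then 1 else 0)
      = S.card * (S.card - 1) := by
    have : ∀ i : Fin m, ∑ j ∈ ({i}ᶜ : Finset (Fin m)), (if j ∈ S ∧ i ∈ S then 1 else 0)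
        = if i ∈ S then S.card - 1 else 0 := fun i => by
      by_cases hi : i ∈ S
      · simp only [hi, and_true, if_true]
        rw [← Finset.card_erase_of_mem hi, Finset.card_eq_sum_ones, ← Finset.sum_filter]
        congr 1
        ext j
        simp
      · simp [hi]
    simp_rw [this]
    rw [← Finset.sum_filter]
    simp
  rw [h2] at h
  rw [Nat.choose_two_right, ← h]
  have h3 : ∀ i j : Fin m, ((if j ∈ S ∧ i ∈ S then 1 else 0) + (if i ∈ S ∧ j ∈ S then 1 else 0) : ℕ)
      = 2 * (if i ∈ S ∧ j ∈ S then 1 else 0) := fun i j => by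
    simp only [and_comm (a := j ∈ S)]; ring
  simp_rw [h3, ← Finset.mul_sum]
  simp

lemma vandI {m : ℕ} (x : Fin m → ℂ) (hx : Function.Injective x) (t : ℂ) (I : Finset (Fin m)) :
    (Matrix.vandermonde (fun i => if i ∈ I then x i else t * x i)).det =
      t ^ ((Iᶜ).card.choose 2) * (∏ i ∈ I, ∏ j ∈ Iᶜ, (x i - t * x j) / (x i - x j)) *
        (Matrix.vandermonde x).det := by
  rw [Matrix.det_vandermonde, Matrix.det_vandermonde]
  have h1 : ∏ i ∈ I, ∏ j ∈ Iᶜ, (x i - t * x j) / (x i - x j) =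
      ∏ i, ∏ j ∈ ({i}ᶜ : Finset (Fin m)),
        (if j ∈ I ∧ i ∈ Iᶜ then (x j - t * x i) / (x j - x i) else 1) := by
    rw [Finset.prod_comm]
    have : ∀ i : Fin m, ∏ j ∈ ({i}ᶜ : Finset (Fin m)),
        (if j ∈ I ∧ i ∈ Iᶜ then (x j - t * x i) / (x j - x i) else 1) =
        if i ∈ Iᶜ then ∏ j ∈ I, (x j - t * x i) / (x j - x i) else 1 := fun i => by
      by_cases hi : i ∈ Iᶜ
      · simp only [hi, and_true, if_true]
        rw [← Finset.prod_filter]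
        apply Finset.prod_congr _ (fun _ _ => rfl)
        ext j
        simp only [Finset.mem_filter, Finset.mem_compl, Finset.mem_singleton]
        constructor
        · exact fun h => h.2
        · intro h
          refine ⟨?_, h⟩
          rintro rfl
          simp [h] at hi
      · simp [hi]
    simp_rw [this]
    rw [← Finset.prod_filter]
    apply Finset.prod_congr _ (fun _ _ => rfl)
    ext; simp
  rw [h1, ← Finset.prod_prod_Ioi_mul_eq_prod_prod_off_diag
    (fun j i => if j ∈ I ∧ i ∈ Iᶜ then (x j - t * x i) / (x j - x i) else 1), ← pairCount]
  simp_rw [← Finset.prod_pow_eq_pow_sum, ← Finset.prod_mul_distrib]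
  refine Finset.prod_congr rfl fun i _ => Finset.prod_congr rfl fun j hj => ?_
  have hne : i ≠ j := (Finset.mem_Ioi.1 hj).ne
  have h1 : x i - x j ≠ 0 := sub_ne_zero.2 fun h => hne (hx h)
  have h2 : x j - x i ≠ 0 := sub_ne_zero.2 fun h => hne (hx h).symm
  by_cases hi : i ∈ I <;> by_cases hj : j ∈ I <;> simp [hi, hj]
  · field_simp; ring
  · field_simp
  · ring

lemma detExp {m : ℕ} (x f : Fin m → ℂ) (hx : Function.Injective x) (t c : ℂ) :
    (Matrix.of fun i k : Fin m => x i ^ (k:ℕ) * (t ^ (k:ℕ) - c * f i)).det =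
    ∑ I : Finset (Fin m), (-1)^I.card * c ^ I.card * t ^ ((Iᶜ).card.choose 2) *
      (∏ i ∈ I, ∏ j ∈ Iᶜ, (x i - t * x j) / (x i - x j)) * (∏ i ∈ I, f i) *
        (Matrix.vandermonde x).det := by
  have h0 : (Matrix.of fun i k : Fin m => x i ^ (k:ℕ) * (t ^ (k:ℕ) - c * f i)) =
    (fun (i k : Fin m) => (-c * f i) * x i ^ (k:ℕ)) + (fun (i k : Fin m) => (t * x i)^(k:ℕ)) := by
    ext i k
    simp [mul_pow]; ring
  have := (Matrix.detRowAlternating (R := ℂ) (n := Fin m)).map_add_univ 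
    (fun i k => (-c * f i) * x i ^ (k:ℕ)) (fun i k => (t * x i)^(k:ℕ))
  rw [h0]
  refine this.trans (Finset.sum_congr rfl fun I _ => ?_)
  have h3 : (I.piecewise (fun (i k : Fin m) => (-c * f i) * x i ^ (k:ℕ)) (fun i k => (t * x i)^(k:ℕ)))
    = (Matrix.of fun i k => (if i ∈ I then -c * f i else 1) * Matrix.vandermonde (fun i => if i ∈ I then x i else t * x i) i k) := by
    ext i k
    by_cases hi : i ∈ I <;> simp [hi, Matrix.vandermonde_apply]
  rw [h3]
  change Matrix.det _ = _
  rw [Matrix.det_mul_column, vandI x hx, ← Finset.prod_filter]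
  simp only [Finset.filter_mem_eq_inter, Finset.univ_inter, Finset.prod_mul_distrib, Finset.prod_const]
  rw [neg_pow]
  ring

lemma chooseId (r s : ℕ) : r.choose 2 + (r+s).choose 2 = (r+s-1) * r + s.choose 2 := by
  have h : ∀ n : ℕ, ((n.choose 2 : ℕ) : ℚ) = n * (n-1) / 2 := fun n => Nat.cast_choose_two ℚ n
  rcases Nat.eq_zero_or_pos (r+s) with h0 | h0
  · obtain ⟨rfl, rfl⟩ : r = 0 ∧ s = 0 := by omega
    rfl
  · have : ((r + s - 1 : ℕ) : ℚ) = r + s - 1 := by push_cast [Nat.cast_sub h0]; ring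
    have : ((r.choose 2 + (r+s).choose 2 : ℕ) : ℚ) = (((r+s-1) * r + s.choose 2 : ℕ) : ℚ) := by
      rw [Nat.cast_add, Nat.cast_add, Nat.cast_mul, this, h, h, h]; push_cast; ring
    exact_mod_cast this

lemma omegaDet {m n : ℕ} (t : ℂ) (x : Fin m → ℂ) (y : Fin n → ℂ) (hx : Function.Injective x) :
    bisymOmega t x y * (t ^ (m.choose 2) * (Matrix.vandermonde x).det) =
    (Matrix.of fun i k : Fin m => x i ^ (k:ℕ) * (t ^ (k:ℕ) - t ^ (m-1) *
      ∏ j, (x i - y j) / (x i - t * y j))).det := by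
  rw [detExp x _ hx, bisymOmega, Finset.sum_mul]
  refine Finset.sum_congr rfl fun I _ => ?_
  have hc : I.card + (Iᶜ).card = m := by simpa using Finset.card_add_card_compl I
  have := chooseId I.card (Iᶜ).card
  rw [hc] at this
  have h2 : t ^ (I.card.choose 2) * t ^ (m.choose 2) = (t ^ (m-1)) ^ I.card * t ^ ((Iᶜ).card.choose 2) := by
    rw [← pow_add, this, pow_add, pow_mul]
  linear_combination ((-1) ^ I.card * (∏ i ∈ I, ∏ j ∈ Iᶜ, (x i - t * x j) / (x i - x j)) *
      (∏ i ∈ I, ∏ j, (x i - y j) / (x i - t * y j)) * (Matrix.vandermonde x).det) * h2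

lemma entryLim {n : ℕ} (a : ℂ) (y : Fin n → ℂ) (h : ∀ j, a ≠ y j) (k M : ℕ) :
    Tendsto (fun t : ℂ => (t ^ k - t ^ M * ∏ j, (a - y j) / (a - t * y j)) / (1 - t))
      (nhdsWithin 1 {(1 : ℂ)}ᶜ) (nhds (-((∑ j, y j / (y j - a)) - ((M:ℂ) - k)))) := by
  have hf : ∀ j ∈ Finset.univ, HasDerivAt (fun t : ℂ => (a - y j) / (a - t * y j)) (y j / (a - y j)) 1 := by
    intro j _
    have hne : a - y j ≠ 0 := sub_ne_zero.2 (h j)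
    have h1 : HasDerivAt (fun t : ℂ => a - t * y j) (-(1 * y j)) 1 :=
      ((hasDerivAt_id (1:ℂ)).mul_const (y j)).const_sub a
    have := (hasDerivAt_const (1:ℂ) (a - y j)).fun_div h1 (by simpa using hne)
    refine this.congr_deriv ?_
    simp only [one_mul]
    field_simp
    ring
  have hp := HasDerivAt.fun_finsetProd hf
  have hone : ∀ j, (a - y j) / (a - 1 * y j) = 1 := fun j => by
    rw [one_mul, div_self (sub_ne_zero.2 (h j))]
  have ht := ((hasDerivAt_pow k (1:ℂ)).fun_sub ((hasDerivAt_pow M (1:ℂ)).fun_mul hp))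
  have hs := ht.tendsto_slope.neg
  simp only [hone] at hs
  have hv : -((∑ j, y j / (y j - a)) - ((M:ℂ) - k)) = -((k:ℂ) * 1 ^ (k-1) - ((M:ℂ) * 1 ^ (M-1) * ∏ j : Fin n, (1:ℂ) + 1 ^ M * ∑ i : Fin n, (∏ j ∈ Finset.univ.erase i, (1:ℂ)) • (y i / (a - y i)))) := by
    have : ∀ j, y j / (y j - a) = - (y j / (a - y j)) := fun j => by
      rw [← neg_sub a, div_neg]
    simp [this]
    ring
  rw [hv]
  refine hs.congr fun t => ?_
  simp only [slope, hone, vsub_eq_sub, smul_eq_mul, one_pow, Finset.prod_const_one, mul_one, sub_self, sub_zero]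
  rw [← neg_sub t 1, div_neg, div_eq_inv_mul]


/-- The limit `t → 1` of `ω(x,y;t)/(1-t)^m` (Equation (3.19)); the sum over tuples
of pairwise distinct indices in `{1,…,n}` is encoded as a sum over embeddings
`Fin m ↪ Fin n`. -/
theorem bisymOmega_limit {m n : ℕ} (hmn : m ≤ n)
    (x : Fin m → ℂ) (y : Fin n → ℂ)
    (hx : Function.Injective x) (hy : Function.Injective y)
    (hxy : ∀ (i : Fin m) (j : Fin n), x i ≠ y j) :
    Tendsto (fun t : ℂ => bisymOmega t x y / (1 - t) ^ m)
      (nhdsWithin 1 {(1 : ℂ)}ᶜ)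
      (nhds ((-1 : ℂ) ^ m *
        ∑ l : Fin m ↪ Fin n, ∏ i : Fin m, y (l i) / (y (l i) - x i))) := by
  have hV : (Matrix.vandermonde x).det ≠ 0 := Matrix.det_vandermonde_ne_zero_iff.2 hx
  have hL : Tendsto (fun t : ℂ => (Matrix.of fun i k : Fin m => x i ^ (k:ℕ) * ((t ^ (k:ℕ) - t ^ (m-1) *
      ∏ j, (x i - y j) / (x i - t * y j)) / (1 - t))).det) (nhdsWithin 1 {(1 : ℂ)}ᶜ)
      (nhds ((Matrix.of fun i k : Fin m => x i ^ (k:ℕ) *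
        (-((∑ j, y j / (y j - x i)) - (((m-1:ℕ):ℂ) - (k:ℕ))))).det)) := by
    refine ((continuous_id.matrix_det (R := ℂ) (n := Fin m)).tendsto _).comp ?_
    refine tendsto_pi_nhds.2 fun i => tendsto_pi_nhds.2 fun k => ?_
    exact (entryLim (x i) y (hxy i) k (m-1)).const_mul _
  have hval : (Matrix.of fun i k : Fin m => x i ^ (k:ℕ) *
        (-((∑ j, y j / (y j - x i)) - (((m-1:ℕ):ℂ) - (k:ℕ))))).det =
      (-1) ^ m * ((Matrix.vandermonde x).det *
        ∑ l : Fin m ↪ Fin n, ∏ i : Fin m, y (l i) / (y (l i) - x i)) := by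
    rw [mainId x y hxy, Dt]
    have := Matrix.det_neg (Matrix.of fun i k : Fin m =>
      x i ^ (k:ℕ) * ((∑ j, y j / (y j - x i)) - ((m:ℂ) - 1 - (k:ℕ))))
    rw [Fintype.card_fin] at this
    rw [← this]
    congr 1
    ext i k
    have hm : 1 ≤ m := Nat.one_le_of_lt i.2
    simp [Nat.cast_sub hm]
    ring
  have ht : Tendsto (fun t : ℂ => t ^ (m.choose 2) * (Matrix.vandermonde x).det)
      (nhdsWithin 1 {(1 : ℂ)}ᶜ) (nhds (1 ^ (m.choose 2) * (Matrix.vandermonde x).det)) :=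
    (Continuous.tendsto (by fun_prop) 1).mono_left nhdsWithin_le_nhds
  have hdiv := hL.div ht (by simpa using hV)
  rw [hval] at hdiv
  have hlim : (-1 : ℂ) ^ m * ((Matrix.vandermonde x).det *
        ∑ l : Fin m ↪ Fin n, ∏ i : Fin m, y (l i) / (y (l i) - x i)) /
        (1 ^ (m.choose 2) * (Matrix.vandermonde x).det) = (-1 : ℂ) ^ m *
        ∑ l : Fin m ↪ Fin n, ∏ i : Fin m, y (l i) / (y (l i) - x i) := by
    rw [one_pow, one_mul]
    field_simp
  rw [hlim] at hdiv
  refine hdiv.congr' ?_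
  have h0 : ∀ᶠ t in nhdsWithin (1:ℂ) {(1 : ℂ)}ᶜ, t ≠ 0 :=
    nhdsWithin_le_nhds (isOpen_ne.mem_nhds one_ne_zero)
  filter_upwards [h0, self_mem_nhdsWithin] with t ht0 ht1
  have h1 : (1 - t) ≠ 0 := sub_ne_zero.2 (Ne.symm ht1)
  have h2 : t ^ (m.choose 2) ≠ 0 := pow_ne_zero _ ht0
  have hd := omegaDet t x y hx
  have hs : (Matrix.of fun i k : Fin m => x i ^ (k:ℕ) * (t ^ (k:ℕ) - t ^ (m-1) *
      ∏ j, (x i - y j) / (x i - t * y j))) = (1 - t) • (Matrix.of fun i k : Fin m => x i ^ (k:ℕ) * ((t ^ (k:ℕ) - t ^ (m-1) *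
      ∏ j, (x i - y j) / (x i - t * y j)) / (1 - t))) := by
    ext i k
    simp only [Matrix.smul_apply, Matrix.of_apply, smul_eq_mul]
    rw [mul_left_comm, mul_div_cancel₀ _ h1]
  rw [hs, Matrix.det_smul, Fintype.card_fin] at hd
  simp only [Pi.div_apply]
  rw [div_eq_div_iff (mul_ne_zero h2 hV) (pow_ne_zero _ h1)]
  linear_combination -hd
end
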